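/- arXiv:1210.6729 — 4 statements merged into one kernel-verified Lean document; each statement's English description precedes it below -/
import Mathlib

section
/- Fix positive integers t ≤ m ≤ n, let X be an m×n matrix of indeterminates over a field 𝔽 of prime characteristic, R = 𝔽[X], and for 1 ≤ j ≤ m let I_j be the ideal of j×j minors of X. Let k be an integer with 0 ≤ k ≤ t−1, let δ_k be any k×k minor of X (with δ_k = 1 if k = 0) and δ_t any t×t minor of X. Then δ_k^{t−k−1}·δ_t lies in the integral closure of I_{k+1}^{t−k}; consequently δ_k^{t−k−1}·I_t is contained in the integral closure of I_{k+1}^{t−k}. -/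
open MvPolynomial

/-- The generic `m × n` matrix `X`, whose entries are the variables `x_{ij}` of the
polynomial ring `𝔽[X]`. -/
noncomputable def genMat (𝔽 : Type*) [Field 𝔽] (m n : ℕ) :
    Matrix (Fin m) (Fin n) (MvPolynomial (Fin m × Fin n) 𝔽) :=
  Matrix.of fun i j => MvPolynomial.X (i, j)

/-- `f` is a size `s` minor of the generic `m × n` matrix: the determinant of the submatrix
obtained by choosing `s` rows and `s` columns (in increasing order). -/
def IsMinor (𝔽 : Type*) [Field 𝔽] (m n s : ℕ) (f : MvPolynomial (Fin m × Fin n) 𝔽) : Prop :=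
  ∃ (row : Fin s → Fin m) (col : Fin s → Fin n), StrictMono row ∧ StrictMono col ∧
    f = ((genMat 𝔽 m n).submatrix row col).det

/-- `I_s ⊆ 𝔽[X]`, the ideal generated by the size `s` minors of the generic matrix. -/
noncomputable def minorsIdeal (𝔽 : Type*) [Field 𝔽] (m n s : ℕ) :
    Ideal (MvPolynomial (Fin m × Fin n) 𝔽) :=
  Ideal.span {f | IsMinor 𝔽 m n s f}

/-- `x` lies in the integral closure of the ideal `J`: it satisfies an equation
`x^d + a_1 x^{d-1} + ⋯ + a_d = 0` with `a_i ∈ J^i`. -/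
def MemIntClosure {R : Type*} [CommRing R] (J : Ideal R) (x : R) : Prop :=
  ∃ (d : ℕ) (a : ℕ → R), 0 < d ∧ (∀ i ∈ Finset.Icc 1 d, a i ∈ J ^ i) ∧
    x ^ d + ∑ i ∈ Finset.Icc 1 d, a i * x ^ (d - i) = 0

/-- The Schur complement of the entry `A i₀ j₀`: the result of clearing column `j₀` of `A`
with row `i₀`. -/
noncomputable def Matrix.pivotReduce {ι κ K : Type*} [Field K] (A : Matrix ι κ K) (i₀ : ι)
    (j₀ : κ) : Matrix ι κ K :=
  Matrix.of fun i j => A i j - A i j₀ / A i₀ j₀ * A i₀ j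

theorem Matrix.mul_det_pivotReduce {ι κ K : Type*} [Field K] (A : Matrix ι κ K) {i₀ : ι} {j₀ : κ}
    (h : A i₀ j₀ ≠ 0) {s : ℕ} (r : Fin s → ι) (c : Fin s → κ) :
    A i₀ j₀ * ((A.pivotReduce i₀ j₀).submatrix r c).det =
      (A.submatrix (Fin.cons i₀ r : Fin (s + 1) → ι) (Fin.cons j₀ c : Fin (s + 1) → κ)).det := by
  let B : Matrix (Fin (s + 1)) (Fin (s + 1)) K := Matrix.of fun i j =>
    (Fin.cons (A i₀ ((Fin.cons j₀ c : Fin (s + 1) → κ) j))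
      (fun i => A.pivotReduce i₀ j₀ (r i) ((Fin.cons j₀ c : Fin (s + 1) → κ) j)) :
      Fin (s + 1) → K) i
  rw [Matrix.det_eq_of_forall_row_eq_smul_add_const (B := B)
    (Fin.cons 0 fun i => A (r i) j₀ / A i₀ j₀) 0 rfl, Matrix.det_succ_column_zero,
    Fin.sum_univ_succ, Finset.sum_eq_zero]
  · simp only [Fin.val_zero, pow_zero, one_mul, add_zero]
    rfl
  · intro i _
    simp [B, Matrix.pivotReduce, h]
  · intro i j
    cases i using Fin.cases <;> simp [B, Matrix.pivotReduce]

theorem Matrix.det_add_mul_eq {K : Type*} [CommRing K] {s : ℕ}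
    (B : Matrix (Fin (s + 1)) (Fin (s + 1)) K) (u w : Fin (s + 1) → K) :
    (Matrix.of fun i j => B i j + u i * w j).det = B.det +
      ∑ j : Fin (s + 1), (-1) ^ (j : ℕ) * w j * ∑ i : Fin (s + 1), (-1) ^ (i : ℕ) * u i *
        (B.submatrix i.succAbove j.succAbove).det := by
  let N : Matrix (Fin (s + 2)) (Fin (s + 2)) K := Matrix.of
    (Fin.cons (Fin.cons 1 w) fun i => Fin.cons 0 fun j => B i j + u i * w j)
  let N' : Matrix (Fin (s + 2)) (Fin (s + 2)) K := Matrix.of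
    (Fin.cons (Fin.cons 1 w) fun i => Fin.cons (-u i) (B i))
  have h₁ : (Matrix.of fun i j => B i j + u i * w j).det = N.det := by
    rw [Matrix.det_succ_column_zero N, Fin.sum_univ_succ, Finset.sum_eq_zero]
    · simp [N]
      rfl
    · intro i _
      simp [N]
  have h₂ : N.det = N'.det := by
    refine Matrix.det_eq_of_forall_row_eq_smul_add_const (Fin.cons 0 u) 0 rfl fun i j => ?_
    cases i using Fin.cases <;> cases j using Fin.cases <;> simp [N, N']
  rw [h₁, h₂, Matrix.det_succ_row_zero, Fin.sum_univ_succ]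
  congr 1
  · simp [N']
    rfl
  · refine Finset.sum_congr rfl fun j _ => ?_
    rw [Matrix.det_succ_column_zero]
    have h₃ (i : Fin (s + 1)) : (N'.submatrix Fin.succ j.succ.succAbove).submatrix i.succAbove
        Fin.succ = B.submatrix i.succAbove j.succAbove := by
      ext x y
      simp [N']
    simp only [h₃]
    simp [N', pow_succ, Finset.mul_sum]

section Valuation

variable {K Γ : Type*} [Field K] [LinearOrderedCommGroupWithZero Γ] (v : Valuation K Γ)

theorem Valuation.map_det_succ_le {s : ℕ} (B : Matrix (Fin (s + 1)) (Fin (s + 1)) K) {a μ : Γ}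
    (hB : ∀ i j, v (B i j) ≤ a)
    (hμ : ∀ i j : Fin (s + 1), v (B.submatrix i.succAbove j.succAbove).det ≤ μ) :
    v B.det ≤ a * μ := by
  rw [Matrix.det_succ_column_zero]
  refine v.map_sum_le fun i _ => ?_
  simpa [map_mul] using mul_le_mul' (hB i 0) (hμ i 0)

theorem Valuation.map_det_le_pow {s : ℕ} (B : Matrix (Fin s) (Fin s) K) {a : Γ}
    (hB : ∀ i j, v (B i j) ≤ a) : v B.det ≤ a ^ s := by
  induction s with
  | zero => simp
  | succ s ih =>
    rw [pow_succ']
    exact v.map_det_succ_le B hB fun i j => ih _ fun _ _ => hB _ _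

variable {ι κ : Type*} (A : Matrix ι κ K)

theorem Valuation.exists_map_det_submatrix_le [Finite ι] [Finite κ] {i₀ : ι} {j₀ : κ}
    (hmax : ∀ i j, v (A i j) ≤ v (A i₀ j₀)) {s : ℕ}
    (r : Fin (s + 1) → ι) (c : Fin (s + 1) → κ) :
    ∃ (r' : Fin s → ι) (c' : Fin s → κ), v (A.submatrix r c).det ≤
      v (A i₀ j₀) * v ((A.pivotReduce i₀ j₀).submatrix r' c').det := by
  have : Nonempty ι := ⟨i₀⟩
  have : Nonempty κ := ⟨j₀⟩
  obtain ⟨⟨r', c'⟩, hrc⟩ := Finite.exists_max fun x : (Fin s → ι) × (Fin s → κ) =>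
    v ((A.pivotReduce i₀ j₀).submatrix x.1 x.2).det
  refine ⟨r', c', ?_⟩
  have hu (i : ι) : v (A i j₀ / A i₀ j₀) ≤ 1 := by
    rw [map_div₀]
    exact div_le_one_of_le₀ (hmax _ _) zero_le
  have hsub : A.submatrix r c = Matrix.of fun i j =>
      ((A.pivotReduce i₀ j₀).submatrix r c) i j + A (r i) j₀ / A i₀ j₀ * A i₀ (c j) := by
    ext i j
    simp [Matrix.pivotReduce]
  rw [hsub, Matrix.det_add_mul_eq]
  refine v.map_add_le (v.map_det_succ_le _ (fun i j => ?_) fun i j => ?_)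
    (v.map_sum_le fun j _ => ?_)
  · refine v.map_sub_le (hmax _ _) ?_
    rw [map_mul]
    exact mul_le_of_le_one_of_le (hu _) (hmax _ _)
  · exact hrc (r ∘ i.succAbove, c ∘ j.succAbove)
  · rw [map_mul]
    refine mul_le_mul' (by simpa using hmax _ _) (v.map_sum_le fun i _ => ?_)
    rw [map_mul]
    exact mul_le_of_le_one_of_le (by simpa using hu (r i))
      (hrc (r ∘ i.succAbove, c ∘ j.succAbove))

/-- Log-concavity of the maximal values of the minors of a matrix over a valued field. -/
theorem Valuation.map_det_pow_mul_le [Finite ι] [Finite κ] {k s t : ℕ} (ht : t = k + s + 1) {b : Γ}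
    (hb : ∀ (r : Fin (k + 1) → ι) (c : Fin (k + 1) → κ), v (A.submatrix r c).det ≤ b)
    (r : Fin k → ι) (c : Fin k → κ) (r' : Fin t → ι) (c' : Fin t → κ) :
    v (A.submatrix r c).det ^ s * v (A.submatrix r' c').det ≤ b ^ (s + 1) := by
  induction k generalizing A t b with
  | zero =>
    obtain rfl : t = s + 1 := by omega
    simpa using v.map_det_le_pow (A.submatrix r' c') fun i j => by
      simpa using hb (fun _ => r' i) fun _ => c' j
  | succ k ih =>
    obtain ⟨t, rfl⟩ : ∃ t', t = t' + 1 := ⟨k + 1 + s, ht⟩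
    have : Nonempty ι := ⟨r 0⟩
    have : Nonempty κ := ⟨c 0⟩
    obtain ⟨⟨i₀, j₀⟩, hmax⟩ := Finite.exists_max fun x : ι × κ => v (A x.1 x.2)
    replace hmax : ∀ i j, v (A i j) ≤ v (A i₀ j₀) := fun i j => hmax (i, j)
    by_cases h : A i₀ j₀ = 0
    · have hA : A = 0 := by
        ext i j
        simpa [h] using hmax i j
      simp [hA, Matrix.det_zero]
    · have ha : 0 < v (A i₀ j₀) := by simpa [zero_lt_iff] using h
      obtain ⟨r₁, c₁, h₁⟩ := v.exists_map_det_submatrix_le A hmax r c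
      obtain ⟨r₂, c₂, h₂⟩ := v.exists_map_det_submatrix_le A hmax r' c'
      have h₃ := ih (A.pivotReduce i₀ j₀) (by omega : t = k + s + 1) (b := b / v (A i₀ j₀))
        (fun r c => by
          rw [le_div_iff₀ ha, mul_comm, ← map_mul, Matrix.mul_det_pivotReduce A h]
          exact hb _ _) r₁ c₁ r₂ c₂
      rw [div_pow, le_div_iff₀ (pow_pos ha _)] at h₃
      refine (mul_le_mul' (pow_le_pow_left' h₁ s) h₂).trans (le_of_eq_of_le ?_ h₃)
      rw [mul_pow, pow_succ]
      ac_rfl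

end Valuation

section IntegralClosure

variable {R : Type*} [CommRing R]

theorem exists_eq_sum_of_mem_mul_sup_pow {J : Ideal R} {x : R} (d : ℕ) {z : R}
    (hz : z ∈ J * (J ⊔ Ideal.span {x}) ^ d) : ∃ a : ℕ → R, (∀ i, a i ∈ J ^ (i + 1)) ∧
      z = ∑ i ∈ Finset.range (d + 1), a i * x ^ (d - i) := by
  induction d generalizing z with
  | zero => exact ⟨Pi.single 0 z, fun i => by cases i <;> simp_all, by simp⟩
  | succ d ih =>
    rw [pow_succ, ← mul_assoc] at hz
    induction hz using Submodule.mul_induction_on' with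
    | mem_mul_mem y hy w hw =>
      obtain ⟨a, ha, rfl⟩ := ih hy
      obtain ⟨j, hj, q, hq, rfl⟩ := Submodule.mem_sup.mp hw
      obtain ⟨q, rfl⟩ := Ideal.mem_span_singleton'.mp hq
      let b : ℕ → R := fun i => Nat.casesOn i 0 fun i => a i * j
      have hb (i : ℕ) : b i ∈ J ^ (i + 1) := by
        cases i with
        | zero => exact zero_mem _
        | succ i => exact pow_succ J (i + 1) ▸ Ideal.mul_mem_mul (ha i) hj
      refine ⟨fun i => b i + if i ≤ d then q * a i else 0, fun i => add_mem (hb i) ?_, ?_⟩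
      · split_ifs
        exacts [Ideal.mul_mem_left _ _ (ha i), zero_mem _]
      · simp only [add_mul, Finset.sum_add_distrib, mul_add, Finset.sum_mul]
        congr 1
        · rw [Finset.sum_range_succ' _ (d + 1)]
          simp only [show b 0 = 0 from rfl, zero_mul, add_zero, Nat.add_sub_add_right]
          exact Finset.sum_congr rfl fun i _ => mul_right_comm _ _ _
        · rw [Finset.sum_range_succ _ (d + 1), if_neg (by omega), zero_mul, add_zero]
          refine Finset.sum_congr rfl fun i hi => ?_
          rw [Finset.mem_range] at hi
          rw [if_pos (by omega), Nat.succ_sub (by omega : i ≤ d), pow_succ]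
          ring
    | add y _ w _ hy hw =>
      obtain ⟨a, ha, rfl⟩ := hy
      obtain ⟨b, hb, rfl⟩ := hw
      exact ⟨a + b, fun i => add_mem (ha i) (hb i), by
        simp [add_mul, Finset.sum_add_distrib]⟩

theorem memIntClosure_of_pow_mem {J : Ideal R} {x : R} {d : ℕ}
    (h : x ^ (d + 1) ∈ J * (J ⊔ Ideal.span {x}) ^ d) : MemIntClosure J x := by
  obtain ⟨a, ha, hx⟩ := exists_eq_sum_of_mem_mul_sup_pow d h
  refine ⟨d + 1, fun i => -a (i - 1), d.succ_pos, fun i hi => ?_, ?_⟩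
  · rw [Finset.mem_Icc] at hi
    simpa [Nat.sub_add_cancel hi.1] using neg_mem (ha (i - 1))
  · rw [← Finset.Ico_add_one_right_eq_Icc, Finset.sum_Ico_eq_sum_range, hx]
    simp [Finset.sum_neg_distrib, add_comm 1]

/-- The valuative criterion for membership in the integral closure of an ideal. -/
theorem memIntClosure_of_forall_valuationSubring {K : Type*} [Field K] [Algebra R K]
    [FaithfulSMul R K] {J : Ideal R} {x : R}
    (h : ∀ V : ValuationSubring K, (∀ r : R, algebraMap R K r ∈ V) →
      ∃ b ∈ J, V.valuation (algebraMap R K x) ≤ V.valuation (algebraMap R K b)) :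
    MemIntClosure J x := by
  have hinj := FaithfulSMul.algebraMap_injective R K
  by_cases hx : x = 0
  · exact ⟨1, 0, one_pos, by simp, by simp [hx]⟩
  have hx' : algebraMap R K x ≠ 0 := by simpa using hx
  let S : Set K := {y | ∃ b ∈ J, algebraMap R K b / algebraMap R K x = y}
  let A := Algebra.adjoin R S
  have hxJ (d : ℕ) : x ^ d ∈ (J ⊔ Ideal.span {x}) ^ d :=
    Ideal.pow_mem_pow (Ideal.mem_sup_right (Ideal.mem_span_singleton_self x)) d
  have hA (y : K) (hy : y ∈ A) : ∃ d : ℕ, ∃ z ∈ (J ⊔ Ideal.span {x}) ^ d,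
      y * algebraMap R K x ^ d = algebraMap R K z := by
    induction hy using Algebra.adjoin_induction with
    | mem y hy =>
      obtain ⟨b, hb, rfl⟩ := hy
      exact ⟨1, b, by simpa using Ideal.mem_sup_left hb, by field_simp⟩
    | algebraMap r => exact ⟨0, r, by simp, by simp⟩
    | add y w _ _ hy hw =>
      obtain ⟨d, z, hz, hy⟩ := hy
      obtain ⟨e, q, hq, hw⟩ := hw
      refine ⟨d + e, z * x ^ e + x ^ d * q, ?_, ?_⟩
      · rw [pow_add]
        exact add_mem (Ideal.mul_mem_mul hz (hxJ e)) (Ideal.mul_mem_mul (hxJ d) hq)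
      · simp only [map_add, map_mul, map_pow, ← hy, ← hw]
        ring
    | mul y w _ _ hy hw =>
      obtain ⟨d, z, hz, hy⟩ := hy
      obtain ⟨e, q, hq, hw⟩ := hw
      refine ⟨d + e, z * q, ?_, ?_⟩
      · rw [pow_add]
        exact Ideal.mul_mem_mul hz hq
      · simp only [map_mul, ← hy, ← hw]
        ring
  have hSA (y : K) (hy : y ∈ S) : y ∈ A.toSubring := Algebra.subset_adjoin hy
  let I : Ideal A.toSubring := Ideal.span {y | (y : K) ∈ S}
  have hI (y : A.toSubring) (hy : y ∈ I) : ∃ d : ℕ, ∃ z ∈ J * (J ⊔ Ideal.span {x}) ^ d,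
      (y : K) * algebraMap R K x ^ (d + 1) = algebraMap R K z := by
    induction hy using Submodule.span_induction with
    | mem y hy =>
      obtain ⟨b, hb, hy⟩ := hy
      exact ⟨0, b, by simpa using hb, by rw [← hy, zero_add, pow_one, div_mul_cancel₀ _ hx']⟩
    | zero => exact ⟨0, 0, zero_mem _, by simp⟩
    | add y w _ _ hy hw =>
      obtain ⟨d, z, hz, hy⟩ := hy
      obtain ⟨e, q, hq, hw⟩ := hw
      refine ⟨d + e, z * x ^ e + q * x ^ d, ?_, ?_⟩
      · refine add_mem ?_ ?_
        · rw [pow_add, ← mul_assoc]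
          exact Ideal.mul_mem_mul hz (hxJ e)
        · rw [add_comm, pow_add, ← mul_assoc]
          exact Ideal.mul_mem_mul hq (hxJ d)
      · simp only [map_add, map_mul, map_pow, ← hy, ← hw, Subring.coe_add]
        ring
    | smul a y _ hy =>
      obtain ⟨d, z, hz, hy⟩ := hy
      obtain ⟨e, q, hq, ha⟩ := hA a a.2
      refine ⟨d + e, z * q, ?_, ?_⟩
      · rw [pow_add, ← mul_assoc]
        exact Ideal.mul_mem_mul hz hq
      · simp only [map_mul, ← hy, ← ha, smul_eq_mul, Subring.coe_mul]
        ring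
  by_cases htop : I = ⊤
  · obtain ⟨d, z, hz, h₁⟩ := hI 1 (htop ▸ Submodule.mem_top)
    rw [Subring.coe_one, one_mul, ← map_pow] at h₁
    exact memIntClosure_of_pow_mem (hinj h₁ ▸ hz)
  · obtain ⟨V, hAV, hV⟩ := Ideal.image_subset_nonunits_valuationSubring I htop
    obtain ⟨b, hb, hxb⟩ := h V fun r => hAV (A.algebraMap_mem r)
    have hbS : algebraMap R K b / algebraMap R K x ∈ S := ⟨b, hb, rfl⟩
    have hlt : V.valuation (algebraMap R K b / algebraMap R K x) < 1 :=
      hV ⟨⟨_, hSA _ hbS⟩, Ideal.subset_span hbS, rfl⟩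
    rw [map_div₀, div_lt_one₀ (by simpa [zero_lt_iff] using hx)] at hlt
    exact absurd hxb hlt.not_ge

end IntegralClosure

theorem det_submatrix_mem_minorsIdeal (𝔽 : Type*) [Field 𝔽] {m n s : ℕ} (r : Fin s → Fin m)
    (c : Fin s → Fin n) : ((genMat 𝔽 m n).submatrix r c).det ∈ minorsIdeal 𝔽 m n s := by
  by_cases hr : Function.Injective r
  · by_cases hc : Function.Injective c
    · have hmem : ((((genMat 𝔽 m n).submatrix r c).submatrix (Tuple.sort r) id).submatrix id
          (Tuple.sort c)).det ∈ minorsIdeal 𝔽 m n s :=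
        Ideal.subset_span ⟨r ∘ Tuple.sort r, c ∘ Tuple.sort c,
          (Tuple.monotone_sort r).strictMono_of_injective (hr.comp (Equiv.injective _)),
          (Tuple.monotone_sort c).strictMono_of_injective (hc.comp (Equiv.injective _)), rfl⟩
      rw [Matrix.det_permute', Matrix.det_permute] at hmem
      obtain h₁ | h₁ := Int.units_eq_one_or (Equiv.Perm.sign (Tuple.sort c)) <;>
      obtain h₂ | h₂ := Int.units_eq_one_or (Equiv.Perm.sign (Tuple.sort r)) <;>
      simpa [h₁, h₂] using hmem
    · obtain ⟨i, j, hij, hne⟩ := Function.not_injective_iff.mp hc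
      rw [Matrix.det_zero_of_column_eq hne fun l => by simp [hij]]
      exact zero_mem _
  · obtain ⟨i, j, hij, hne⟩ := Function.not_injective_iff.mp hr
    rw [Matrix.det_zero_of_row_eq hne (by ext; simp [hij])]
    exact zero_mem _

theorem minor_pow_mul_memIntClosure (𝔽 : Type*) [Field 𝔽] {m n k s : ℕ} (hm : k < m) (hn : k < n)
    {δ g : MvPolynomial (Fin m × Fin n) 𝔽} (hδ : IsMinor 𝔽 m n k δ)
    (hg : g ∈ minorsIdeal 𝔽 m n (k + s + 1)) :
    MemIntClosure (minorsIdeal 𝔽 m n (k + 1) ^ (s + 1)) (δ ^ s * g) := by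
  let K := FractionRing (MvPolynomial (Fin m × Fin n) 𝔽)
  let φ := algebraMap (MvPolynomial (Fin m × Fin n) 𝔽) K
  refine memIntClosure_of_forall_valuationSubring (K := K) fun V hV => ?_
  have hdet {l : ℕ} (r : Fin l → Fin m) (c : Fin l → Fin n) :
      (((genMat 𝔽 m n).map φ).submatrix r c).det = φ ((genMat 𝔽 m n).submatrix r c).det := by
    rw [RingHom.map_det]
    rfl
  have : Nonempty (Fin m) := ⟨⟨k, hm⟩⟩
  have : Nonempty (Fin n) := ⟨⟨k, hn⟩⟩
  obtain ⟨⟨r₀, c₀⟩, hmax⟩ := Finite.exists_max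
    fun x : (Fin (k + 1) → Fin m) × (Fin (k + 1) → Fin n) =>
      V.valuation (((genMat 𝔽 m n).map φ).submatrix x.1 x.2).det
  refine ⟨((genMat 𝔽 m n).submatrix r₀ c₀).det ^ (s + 1),
    Ideal.pow_mem_pow (det_submatrix_mem_minorsIdeal 𝔽 r₀ c₀) _, ?_⟩
  change V.valuation (φ _) ≤ V.valuation (φ _)
  rw [map_pow, map_pow, ← hdet]
  simp only [map_mul, map_pow]
  obtain ⟨r, c, -, -, rfl⟩ := hδ
  induction hg using Submodule.span_induction with
  | mem g hg =>
    obtain ⟨r', c', -, -, rfl⟩ := hg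
    rw [← hdet, ← hdet]
    exact V.valuation.map_det_pow_mul_le _ rfl (fun r c => hmax (r, c)) r c r' c'
  | zero => simp
  | add x y _ _ hx hy =>
    rw [← map_pow, ← map_mul] at hx hy ⊢
    rw [map_add, mul_add]
    exact V.valuation.map_add_le hx hy
  | smul a x _ hx =>
    rw [smul_eq_mul, map_mul, map_mul, mul_left_comm]
    exact mul_le_of_le_one_of_le ((V.valuation_le_one_iff _).mpr (hV a)) hx

/-- For `0 ≤ k ≤ t-1`, a size `k` minor `δ_k` (the empty minor `δ_0 = 1` when `k = 0`) and a
size `t` minor `δ_t`, the element `δ_k^{t-k-1}·δ_t` lies in the integral closure of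
`I_{k+1}^{t-k}`; consequently every element of `δ_k^{t-k-1}·I_t` lies in that integral
closure. -/
theorem minor_pow_mul_mem_integralClosure (p : ℕ) (hp : p.Prime)
    (𝔽 : Type*) [Field 𝔽] [CharP 𝔽 p]
    (m n t : ℕ) (ht : 0 < t) (htm : t ≤ m) (hmn : m ≤ n)
    (k : ℕ) (hk : k ≤ t - 1)
    (δk δt : MvPolynomial (Fin m × Fin n) 𝔽)
    (hδk : IsMinor 𝔽 m n k δk) (hδt : IsMinor 𝔽 m n t δt) :
    MemIntClosure (minorsIdeal 𝔽 m n (k + 1) ^ (t - k)) (δk ^ (t - k - 1) * δt) ∧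
    ∀ g ∈ minorsIdeal 𝔽 m n t,
      MemIntClosure (minorsIdeal 𝔽 m n (k + 1) ^ (t - k)) (δk ^ (t - k - 1) * g) := by
  obtain ⟨s, rfl⟩ : ∃ s, t = k + s + 1 := ⟨t - k - 1, by omega⟩
  have main : ∀ g ∈ minorsIdeal 𝔽 m n (k + s + 1),
      MemIntClosure (minorsIdeal 𝔽 m n (k + 1) ^ (k + s + 1 - k))
        (δk ^ (k + s + 1 - k - 1) * g) := fun g hg => by
    rw [show k + s + 1 - k - 1 = s by omega, show k + s + 1 - k = s + 1 by omega]
    exact minor_pow_mul_memIntClosure 𝔽 (by omega) (by omega) hδk hg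
  exact ⟨main δt (Ideal.subset_span hδt), main⟩
end

section
/- Fix positive integers t ≤ m ≤ n, let X be an m×n matrix of indeterminates over a field 𝔽 of prime characteristic, R = 𝔽[X], and for 1 ≤ j ≤ m let I_j be the ideal of j×j minors of X. Let k be an integer with 0 ≤ k ≤ t−1 and let δ_k be a k×k minor of X (with δ_k = 1 if k = 0). Then there exists a nonnegative integer N such that (δ_k^{t−k−1}·I_t)^{N+l} ⊆ I_{k+1}^{(t−k)l} for every integer l ≥ 1. -/
open MvPolynomial

namespace Matrix

variable {ι κ ι' κ' : Type*} {S : Type*} [CommRing S]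

/-- The ideal generated by the determinants of all `j × j` matrices obtained from `A` by choosing
`j` rows and `j` columns, in any order and possibly with repetitions. -/
def minorSpan (A : Matrix ι κ S) (j : ℕ) : Ideal S :=
  Ideal.span (Set.range fun rc : (Fin j → ι) × (Fin j → κ) => (A.submatrix rc.1 rc.2).det)

theorem det_submatrix_mem_minorSpan (A : Matrix ι κ S) {j : ℕ} (r : Fin j → ι) (c : Fin j → κ) :
    (A.submatrix r c).det ∈ A.minorSpan j :=
  Ideal.subset_span ⟨(r, c), rfl⟩

theorem minorSpan_le {A : Matrix ι κ S} {j : ℕ} {J : Ideal S}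
    (h : ∀ (r : Fin j → ι) (c : Fin j → κ), (A.submatrix r c).det ∈ J) : A.minorSpan j ≤ J := by
  rw [minorSpan, Ideal.span_le]
  rintro _ ⟨⟨r, c⟩, rfl⟩
  exact h r c

theorem minorSpan_transpose_le (A : Matrix ι κ S) (j : ℕ) : Aᵀ.minorSpan j ≤ A.minorSpan j :=
  minorSpan_le fun r c => by
    rw [← det_transpose, transpose_submatrix, transpose_transpose]
    exact det_submatrix_mem_minorSpan A c r

theorem minorSpan_mul_le_right [Fintype ι'] (U : Matrix ι ι' S) (B : Matrix ι' κ S) (j : ℕ) :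
    (U * B).minorSpan j ≤ B.minorSpan j := by
  classical
  refine minorSpan_le fun r c => ?_
  have h : ((U * B).submatrix r c).det =
      detRowAlternating.toMultilinearMap
        fun i => ∑ x, U (r i) x • (B.submatrix id c) x := by
    change det _ = det _
    congr 1
    ext i k
    simp [mul_apply]
  rw [h, MultilinearMap.map_sum]
  refine Ideal.sum_mem _ fun f _ => ?_
  rw [MultilinearMap.map_smul_univ]
  exact Ideal.mul_mem_left _ _ (det_submatrix_mem_minorSpan B f c)

theorem minorSpan_mul_le_left [Fintype κ'] (B : Matrix ι κ' S) (W : Matrix κ' κ S) (j : ℕ) :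
    (B * W).minorSpan j ≤ B.minorSpan j := by
  have h := (minorSpan_transpose_le (B * W)ᵀ j).trans
    ((transpose_mul B W ▸ minorSpan_mul_le_right Wᵀ Bᵀ j).trans (minorSpan_transpose_le B j))
  rwa [transpose_transpose] at h

theorem map_minorSpan_le {T : Type*} [CommRing T] (φ : S →+* T) (A : Matrix ι κ S) (j : ℕ) :
    (A.map φ).minorSpan j ≤ (A.minorSpan j).map φ :=
  minorSpan_le fun r c => by
    have h : (A.map φ).submatrix r c = φ.mapMatrix (A.submatrix r c) := rfl
    rw [h, ← RingHom.map_det]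
    exact Ideal.mem_map_of_mem φ (det_submatrix_mem_minorSpan A r c)

/-- `A` factors through `B` if `A = U * B * W` for some matrices `U` and `W`. -/
def FactorsThrough [Fintype ι'] [Fintype κ'] (A : Matrix ι κ S) (B : Matrix ι' κ' S) : Prop :=
  ∃ (U : Matrix ι ι' S) (W : Matrix κ' κ S), A = U * B * W

theorem FactorsThrough.minorSpan_le [Fintype ι'] [Fintype κ'] {A : Matrix ι κ S}
    {B : Matrix ι' κ' S} (h : A.FactorsThrough B) (j : ℕ) : A.minorSpan j ≤ B.minorSpan j := by
  obtain ⟨U, W, rfl⟩ := h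
  exact (minorSpan_mul_le_left _ _ j).trans (minorSpan_mul_le_right _ _ j)

theorem FactorsThrough.trans {ι'' κ'' : Type*} [Fintype ι'] [Fintype κ'] [Fintype ι'']
    [Fintype κ''] {A : Matrix ι κ S} {B : Matrix ι' κ' S} {C : Matrix ι'' κ'' S}
    (h : A.FactorsThrough B) (h' : B.FactorsThrough C) : A.FactorsThrough C := by
  obtain ⟨U, W, rfl⟩ := h
  obtain ⟨U', W', rfl⟩ := h'
  exact ⟨U * U', W' * W, by simp only [Matrix.mul_assoc]⟩

theorem FactorsThrough.smul [Fintype ι'] [Fintype κ'] {A : Matrix ι κ S}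
    {B : Matrix ι' κ' S} (h : A.FactorsThrough B) (a : S) : (a • A).FactorsThrough (a • B) := by
  obtain ⟨U, W, rfl⟩ := h
  exact ⟨U, W, by simp⟩

theorem FactorsThrough.one_fromBlocks [Fintype ι'] [Fintype κ'] {A : Matrix ι κ S}
    {B : Matrix ι' κ' S} (h : A.FactorsThrough B) :
    (fromBlocks (1 : Matrix Unit Unit S) 0 0 A).FactorsThrough
      (fromBlocks (1 : Matrix Unit Unit S) 0 0 B) := by
  obtain ⟨U, W, rfl⟩ := h
  exact ⟨fromBlocks 1 0 0 U, fromBlocks 1 0 0 W, by simp [fromBlocks_multiply]⟩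

section Pivot

variable [Fintype ι] [Fintype κ] (B : Matrix ι κ S) (i₀ : ι) (j₀ : κ)

/-- The result of clearing the row `i₀` and the column `j₀` of `B` by means of a pivot `1` in
position `(i₀, j₀)`. -/
def pivotClear : Matrix ι κ S := of fun i j => B i j - B i j₀ * B i₀ j

theorem factorsThrough_pivotClear :
    B.FactorsThrough (fromBlocks (1 : Matrix Unit Unit S) 0 0 (B.pivotClear i₀ j₀)) := by
  classical
  refine ⟨fromCols (of fun i _ => B i j₀) 1, fromRows (of fun _ j => B i₀ j) 1, ?_⟩
  ext i j
  simp [fromCols_mul_fromBlocks, pivotClear, mul_apply, one_apply]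

theorem pivotClear_factorsThrough (h : B i₀ j₀ = 1) :
    (fromBlocks (1 : Matrix Unit Unit S) 0 0 (B.pivotClear i₀ j₀)).FactorsThrough B := by
  classical
  refine ⟨fromRows (of fun _ i => (1 : Matrix ι ι S) i₀ i)
      (of fun i i' => (1 : Matrix ι ι S) i i' - B i j₀ * (1 : Matrix ι ι S) i₀ i'),
    fromCols (of fun j _ => (1 : Matrix κ κ S) j j₀)
      (of fun j' j => (1 : Matrix κ κ S) j' j - (1 : Matrix κ κ S) j' j₀ * B i₀ j), ?_⟩
  ext (i | i) (j | j) <;>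
    simp [mul_apply, pivotClear, sub_mul, mul_sub, one_apply, Finset.sum_sub_distrib, h, mul_assoc]

end Pivot

/-- Over a valuation ring every matrix is equivalent to a diagonal one, up to zero rows and
columns. -/
theorem exists_diagonal_factorsThrough {V : Type*} [CommRing V] [IsDomain V] [ValuationRing V]
    [Fintype ι] [Fintype κ] (A : Matrix ι κ V) :
    ∃ (N : Type) (_ : Fintype N) (_ : DecidableEq N) (d : N → V),
      A.FactorsThrough (diagonal d) ∧ (diagonal d).FactorsThrough A := by
  classical
  induction hc : (Finset.univ.filter fun i => A i ≠ 0).card using Nat.strong_induction_on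
    generalizing A with
  | _ c ih =>
  by_cases hA : A = 0
  · exact ⟨Empty, inferInstance, inferInstance, Empty.elim, ⟨0, 0, by simp [hA]⟩,
      ⟨0, 0, by ext i; exact i.elim⟩⟩
  obtain ⟨i₁, j₁, h₁⟩ : ∃ i j, A i j ≠ 0 := by
    by_contra! h
    exact hA (ext h)
  obtain ⟨⟨i₀, j₀⟩, hdvd⟩ : ∃ p : ι × κ, ∀ q : ι × κ, A p.1 p.2 ∣ A q.1 q.2 := by
    have : Nonempty (ι × κ) := ⟨(i₁, j₁)⟩
    have : IsTrans V fun x y => y ∣ x := ⟨fun _ _ _ h h' => h'.trans h⟩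
    refine Directed.finite_le (r := fun x y => y ∣ x) (f := fun p : ι × κ => A p.1 p.2)
      (fun p q => ?_) id
    rcases ValuationRing.dvd_total (A p.1 p.2) (A q.1 q.2) with h | h
    exacts [⟨p, dvd_rfl, h⟩, ⟨q, h, dvd_rfl⟩]
  have ha : A i₀ j₀ ≠ 0 := fun h => h₁ (zero_dvd_iff.mp (h ▸ hdvd (i₁, j₁)))
  choose b hb using fun i j => hdvd (i, j)
  set a := A i₀ j₀
  let B : Matrix ι κ V := of b
  have hAB : A = a • B := by ext i j; simpa [B] using hb i j
  have hB : B i₀ j₀ = 1 := mul_left_cancel₀ ha (by simpa [B] using (hb i₀ j₀).symm)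
  have hcard : (Finset.univ.filter fun i => B.pivotClear i₀ j₀ i ≠ 0).card < c := by
    rw [← hc]
    refine Finset.card_lt_card (Finset.ssubset_iff_of_subset ?_ |>.mpr ⟨i₀, ?_, ?_⟩)
    · intro i
      simp only [Finset.mem_filter, Finset.mem_univ, true_and]
      contrapose!
      intro hi
      have hBi : ∀ j, B i j = 0 := fun j => by
        have := congrFun hi j
        rw [hAB] at this
        simpa [ha] using this
      ext j
      simp [pivotClear, hBi]
    · simpa using fun h => ha (congrFun h j₀)
    · simp only [Finset.mem_filter, Finset.mem_univ, true_and, not_not]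
      ext j
      simp [pivotClear, hB]
  obtain ⟨N, _, _, d, h, h'⟩ := ih _ hcard (B.pivotClear i₀ j₀) rfl
  have hD : diagonal (a • Sum.elim (fun _ : Unit => (1 : V)) d) =
      a • fromBlocks (1 : Matrix Unit Unit V) 0 0 (diagonal d) := by
    rw [diagonal_smul, ← fromBlocks_diagonal, diagonal_one]
  refine ⟨Unit ⊕ N, inferInstance, inferInstance, a • Sum.elim (fun _ => 1) d, ?_, ?_⟩
  · rw [hD, hAB]
    exact ((factorsThrough_pivotClear B i₀ j₀).trans h.one_fromBlocks).smul a
  · rw [hD, hAB]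
    exact (h'.one_fromBlocks.trans (pivotClear_factorsThrough B i₀ j₀ hB)).smul a

theorem minorSpan_diagonal {N : Type*} [DecidableEq N] (d : N → S) (j : ℕ) :
    (diagonal d).minorSpan j =
      Ideal.span ((fun s : Finset N => ∏ x ∈ s, d x) '' {s | s.card = j}) := by
  apply le_antisymm
  · refine minorSpan_le fun r c => ?_
    by_cases hr : Function.Injective r
    · have h : (diagonal d).submatrix r c =
          of fun i k => d (r i) * ((1 : Matrix N N S).submatrix r c) i k := by
        ext i k
        simp [diagonal_apply, one_apply]
      rw [h, det_mul_column]
      refine Ideal.mul_mem_right _ _ (Ideal.subset_span ⟨Finset.univ.image r, ?_, ?_⟩)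
      · simp [Finset.card_image_of_injective _ hr]
      · simp [Finset.prod_image hr.injOn]
    · simp only [Function.Injective, not_forall] at hr
      obtain ⟨x, y, hxy, hne⟩ := hr
      rw [det_zero_of_row_eq hne (by ext; simp [hxy])]
      exact zero_mem _
  · rw [Ideal.span_le]
    rintro _ ⟨s, hs, rfl⟩
    let e : Fin j ≃ s := (Finset.equivFinOfCardEq hs).symm
    have h : (diagonal d).submatrix (fun i => (e i : N)) (fun i => (e i : N)) =
        diagonal fun i => d (e i) := by
      ext i k
      simp [diagonal_apply]
    have := det_submatrix_mem_minorSpan (diagonal d) (fun i => (e i : N)) (fun i => (e i : N))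
    rw [h, det_diagonal, Equiv.prod_comp e fun x => d x, Finset.prod_coe_sort s d] at this
    exact this

theorem minorSpan_diagonal_mul_le {N : Type*} [DecidableEq N] (d : N → S) {j k : ℕ} (h : j ≤ k) :
    (diagonal d).minorSpan j * (diagonal d).minorSpan (k + 1) ≤
      (diagonal d).minorSpan (j + 1) * (diagonal d).minorSpan k := by
  simp only [minorSpan_diagonal]
  rw [Ideal.span_mul_span', Ideal.span_le]
  rintro _ ⟨_, ⟨s, hs, rfl⟩, _, ⟨t, ht, rfl⟩, rfl⟩
  simp only [Set.mem_ofPred_eq] at hs ht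
  obtain ⟨x, hxt, hxs⟩ := Finset.exists_mem_notMem_of_card_lt_card (s := s) (t := t) (by omega)
  have heq : (∏ y ∈ s, d y) * ∏ y ∈ t, d y =
      (∏ y ∈ insert x s, d y) * ∏ y ∈ t.erase x, d y := by
    rw [Finset.prod_insert hxs, ← Finset.mul_prod_erase t d hxt]
    ring
  change (∏ y ∈ s, d y) * ∏ y ∈ t, d y ∈ _
  rw [heq]
  exact Ideal.mul_mem_mul
    (Ideal.subset_span ⟨_, by simp [Finset.card_insert_of_notMem hxs, hs], rfl⟩)
    (Ideal.subset_span ⟨_, by simp [Finset.card_erase_of_mem hxt, ht], rfl⟩)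

/-- Over a valuation ring the ideals of minors of a matrix form a log-concave sequence. -/
theorem minorSpan_mul_le {V : Type*} [CommRing V] [IsDomain V] [ValuationRing V]
    [Fintype ι] [Fintype κ] (A : Matrix ι κ V) {j k : ℕ} (h : j ≤ k) :
    A.minorSpan j * A.minorSpan (k + 1) ≤ A.minorSpan (j + 1) * A.minorSpan k := by
  obtain ⟨N, _, _, d, hA, hd⟩ := exists_diagonal_factorsThrough A
  have hAd : A.minorSpan = (diagonal d).minorSpan :=
    funext fun i => le_antisymm (hA.minorSpan_le i) (hd.minorSpan_le i)
  rw [hAd]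
  exact minorSpan_diagonal_mul_le d h

theorem minorSpan_pow_mul_le {V : Type*} [CommRing V] [IsDomain V] [ValuationRing V]
    [Fintype ι] [Fintype κ] (A : Matrix ι κ V) (k s : ℕ) :
    A.minorSpan k ^ s * A.minorSpan (k + s + 1) ≤ A.minorSpan (k + 1) ^ (s + 1) := by
  induction s with
  | zero => simp
  | succ s ih =>
    calc A.minorSpan k ^ (s + 1) * A.minorSpan (k + (s + 1) + 1)
        = A.minorSpan k ^ s * (A.minorSpan k * A.minorSpan (k + s + 1 + 1)) := by
          rw [pow_succ, mul_assoc, ← add_assoc]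
      _ ≤ A.minorSpan k ^ s * (A.minorSpan (k + 1) * A.minorSpan (k + s + 1)) :=
          Ideal.mul_mono_right (minorSpan_mul_le A (by omega))
      _ = A.minorSpan (k + 1) * (A.minorSpan k ^ s * A.minorSpan (k + s + 1)) := by
          ring
      _ ≤ A.minorSpan (k + 1) ^ (s + 1 + 1) := by
          rw [pow_succ' _ (s + 1)]
          exact Ideal.mul_mono_right ih

end Matrix

open scoped Polynomial in
/-- Valuative criterion for an element to be integral over an ideal, the latter being expressed by
means of the Rees algebra. -/
theorem isIntegral_monomial_one_reesAlgebra {R : Type*} [CommRing R] [IsDomain R] {I : Ideal R}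
    {f : R}
    (h : ∀ (V : ValuationSubring (FractionRing R[X])) (φ : R →+* V), φ f ∈ I.map φ) :
    IsIntegral (reesAlgebra I) (Polynomial.monomial 1 f : R[X]) := by
  let F := FractionRing R[X]
  rw [← isIntegral_algebraMap_iff (B := F) (IsFractionRing.injective R[X] F)]
  change _ ∈ (integralClosure (reesAlgebra I) F).toSubring
  by_contra hx
  obtain ⟨V, hle, hV⟩ := Subring.exists_le_valuationSubring_of_isIntegrallyClosedIn hx
  apply hV
  have hA : ∀ g ∈ reesAlgebra I, algebraMap R[X] F g ∈ V := fun g hg =>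
    hle (isIntegral_algebraMap (R := reesAlgebra I) (A := F) (x := ⟨g, hg⟩))
  let φ : R →+* V := ((algebraMap R[X] F).comp Polynomial.C).codRestrict V.toSubring fun r =>
    hA _ ((reesAlgebra I).algebraMap_mem r)
  let T : Ideal V :=
    { carrier := {v | (v : F) * algebraMap R[X] F Polynomial.X ∈ V}
      add_mem' := fun {a b} ha hb => by
        simpa [add_mul] using V.add_mem _ _ ha hb
      zero_mem' := by simp
      smul_mem' := fun c v hv => by
        simpa [mul_assoc] using V.mul_mem _ _ c.2 hv }
  have hφ : ∀ r, (φ r : F) * algebraMap R[X] F Polynomial.X =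
      algebraMap R[X] F (Polynomial.monomial 1 r) := fun r => by
    change algebraMap R[X] F (Polynomial.C r) * _ = _
    rw [← map_mul, Polynomial.C_mul_X_eq_monomial]
  have hT : I.map φ ≤ T := Ideal.map_le_iff_le_comap.mpr fun g hg => by
    change (φ g : F) * algebraMap R[X] F Polynomial.X ∈ V
    rw [hφ]
    exact hA _ (reesAlgebra.monomial_mem.mpr (by simpa using hg))
  have := hT (h V φ)
  change (φ f : F) * algebraMap R[X] F Polynomial.X ∈ V at this
  rwa [hφ] at this

open scoped Polynomial in
/-- If finitely many elements are integral over `I`, then the powers of the ideal they generate are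
contained in those of `I`, up to a constant shift of the exponent. -/
theorem exists_pow_add_le_pow_of_isIntegral {R : Type*} [CommRing R] {I : Ideal R} {s : Set R}
    (hs : s.Finite) (h : ∀ f ∈ s, IsIntegral (reesAlgebra I) (Polynomial.monomial 1 f : R[X])) :
    ∃ N : ℕ, ∀ l : ℕ, Ideal.span s ^ (N + l) ≤ I ^ l := by
  let B := Algebra.adjoin (reesAlgebra I) ((Polynomial.monomial 1 : R →ₗ[R] R[X]) '' s)
  obtain ⟨G, hG⟩ : B.toSubmodule.FG :=
    fg_adjoin_of_finite (hs.image _) (by rintro _ ⟨f, hf, rfl⟩; exact h f hf)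
  have hmem : ∀ i, ∀ f ∈ Ideal.span s ^ i, (Polynomial.monomial i f : R[X]) ∈ B := by
    intro i f hf
    have hle : Algebra.adjoin R
        (Submodule.map (Polynomial.monomial 1 : R →ₗ[R] R[X]) (Ideal.span s) : Set R[X]) ≤
          B.restrictScalars R := by
      rw [Algebra.adjoin_le_iff, Ideal.span, Submodule.map_span]
      change _ ≤ (B.restrictScalars R).toSubmodule
      rw [Submodule.span_le]
      exact Algebra.subset_adjoin
    exact hle (monomial_mem_adjoin_monomial hf)
  refine ⟨G.sup Polynomial.natDegree, fun l f hf => ?_⟩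
  have hcoeff : ∀ g ∈ Submodule.span (reesAlgebra I) (G : Set R[X]),
      ∀ l, g.coeff (G.sup Polynomial.natDegree + l) ∈ I ^ l := by
    intro g hg
    induction hg using Submodule.span_induction with
    | zero => simp
    | add x y _ _ hx hy =>
      intro l
      rw [Polynomial.coeff_add]
      exact add_mem (hx l) (hy l)
    | mem x hx =>
      intro l
      rcases l.eq_zero_or_pos with rfl | hl
      · simp
      · have hdeg : x.natDegree ≤ G.sup Polynomial.natDegree := Finset.le_sup hx
        rw [Polynomial.coeff_eq_zero_of_natDegree_lt (by omega)]
        exact zero_mem _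
    | smul a x _ hx =>
      intro l
      change ((a : R[X]) * x).coeff _ ∈ _
      rw [Polynomial.coeff_mul]
      refine Ideal.sum_mem _ fun ⟨i, j⟩ hij => ?_
      rw [Finset.HasAntidiagonal.mem_antidiagonal] at hij
      have ha : (a : R[X]).coeff i ∈ I ^ i := a.2 i
      rcases le_total j (G.sup Polynomial.natDegree) with hj | hj
      · exact Ideal.mul_mem_right _ _ (Ideal.pow_le_pow_right (by omega) ha)
      · obtain ⟨l', rfl⟩ := Nat.exists_eq_add_of_le hj
        obtain rfl : l = i + l' := by omega
        rw [pow_add]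
        exact Ideal.mul_mem_mul ha (hx l')
  have hfB : (Polynomial.monomial (G.sup Polynomial.natDegree + l) f : R[X]) ∈
      Subalgebra.toSubmodule B := hmem _ f hf
  rw [← hG] at hfB
  simpa using hcoeff _ hfB l

theorem minorSpan_genMat_le (𝔽 : Type*) [Field 𝔽] (m n s : ℕ) :
    (genMat 𝔽 m n).minorSpan s ≤ minorsIdeal 𝔽 m n s := by
  refine Matrix.minorSpan_le fun r c => ?_
  by_cases hr : Function.Injective r
  swap
  · simp only [Function.Injective, not_forall] at hr
    obtain ⟨x, y, hxy, hne⟩ := hr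
    rw [Matrix.det_zero_of_row_eq hne (by ext; simp [hxy])]
    exact zero_mem _
  by_cases hc : Function.Injective c
  swap
  · simp only [Function.Injective, not_forall] at hc
    obtain ⟨x, y, hxy, hne⟩ := hc
    rw [Matrix.det_zero_of_column_eq hne (by simp [hxy])]
    exact zero_mem _
  have hsorted : ((genMat 𝔽 m n).submatrix (r ∘ Tuple.sort r) (c ∘ Tuple.sort c)).det ∈
      minorsIdeal 𝔽 m n s :=
    Ideal.subset_span ⟨_, _,
      (Tuple.monotone_sort r).strictMono_of_injective (hr.comp (Tuple.sort r).injective),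
      (Tuple.monotone_sort c).strictMono_of_injective (hc.comp (Tuple.sort c).injective), rfl⟩
  have heq : (genMat 𝔽 m n).submatrix r c =
      (((genMat 𝔽 m n).submatrix (r ∘ Tuple.sort r) (c ∘ Tuple.sort c)).submatrix
        (Tuple.sort r).symm id).submatrix id (Tuple.sort c).symm := by
    ext i j
    simp
  rw [heq, Matrix.det_permute', Matrix.det_permute]
  exact Ideal.mul_mem_left _ _ (Ideal.mul_mem_left _ _ hsorted)

theorem finite_setOf_isMinor (𝔽 : Type*) [Field 𝔽] (m n s : ℕ) :
    {f | IsMinor 𝔽 m n s f}.Finite := by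
  refine (Set.finite_range fun rc : (Fin s → Fin m) × (Fin s → Fin n) =>
    ((genMat 𝔽 m n).submatrix rc.1 rc.2).det).subset ?_
  rintro f ⟨r, c, -, -, rfl⟩
  exact ⟨(r, c), rfl⟩

/-- **(Briançon–Skoda consequence)** For `0 ≤ k ≤ t-1` and a size `k` minor `δ_k`
(`δ_0 = 1` when `k = 0`), there is an `N ∈ ℕ` with
`(δ_k^{t-k-1}·I_t)^{N+l} ⊆ I_{k+1}^{(t-k)l}` for every `l ≥ 1`. -/
theorem pow_mul_ideal_pow_le (p : ℕ) (hp : p.Prime)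
    (𝔽 : Type*) [Field 𝔽] [CharP 𝔽 p]
    (m n t : ℕ) (ht : 0 < t) (htm : t ≤ m) (hmn : m ≤ n)
    (k : ℕ) (hk : k ≤ t - 1)
    (δk : MvPolynomial (Fin m × Fin n) 𝔽) (hδk : IsMinor 𝔽 m n k δk) :
    ∃ N : ℕ, ∀ l : ℕ, 1 ≤ l →
      (Ideal.span {δk ^ (t - k - 1)} * minorsIdeal 𝔽 m n t) ^ (N + l) ≤
        minorsIdeal 𝔽 m n (k + 1) ^ ((t - k) * l) := by
  obtain ⟨s, rfl⟩ : ∃ s, t = k + s + 1 := ⟨t - k - 1, by omega⟩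
  rw [show k + s + 1 - k - 1 = s by omega, show k + s + 1 - k = s + 1 by omega, minorsIdeal,
    Ideal.span_mul_span', Set.singleton_mul]
  simp only [pow_mul]
  obtain ⟨N, hN⟩ := exists_pow_add_le_pow_of_isIntegral (I := minorsIdeal 𝔽 m n (k + 1) ^ (s + 1))
    ((finite_setOf_isMinor 𝔽 m n (k + s + 1)).image (δk ^ s * ·)) (by
      rintro _ ⟨g, hg, rfl⟩
      refine isIntegral_monomial_one_reesAlgebra fun V φ => ?_
      have hmem : ∀ {j f}, IsMinor 𝔽 m n j f → φ f ∈ ((genMat 𝔽 m n).map φ).minorSpan j := by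
        rintro j _ ⟨r, c, -, -, rfl⟩
        rw [RingHom.map_det]
        exact Matrix.det_submatrix_mem_minorSpan ((genMat 𝔽 m n).map φ) r c
      rw [map_mul, map_pow, Ideal.map_pow]
      exact Ideal.pow_right_mono ((Matrix.map_minorSpan_le φ _ _).trans
        (Ideal.map_mono (minorSpan_genMat_le 𝔽 m n (k + 1)))) (s + 1)
        (Matrix.minorSpan_pow_mul_le _ k s
          (Ideal.mul_mem_mul (Ideal.pow_mem_pow (hmem hδk) s) (hmem hg))))
  exact ⟨N, fun l _ => hN l⟩
end

section
/- Fix positive integers t ≤ m ≤ n, let X be an m×n matrix of indeterminates over a field 𝔽 of prime characteristic p, R = 𝔽[X], and for 1 ≤ j ≤ m let I_j be the ideal of j×j minors of X. Let k be an integer with 0 ≤ k ≤ t−1. Then there exists a nonnegative integer N such that for all positive integers l and all q = p^e satisfying (t−k)l > (q−1)(m−k)(n−k), one has I_t^{N+l} ⊆ I_{k+1}^{[q]}, where I_{k+1}^{[q]} is the ideal generated by the q-th powers of the elements of I_{k+1}. -/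
open MvPolynomial

/-- The bracket power `J^{[q]}`: the ideal generated by the `q`-th powers of the
elements of `J`. -/
noncomputable def bracketPow {R : Type*} [CommRing R] (J : Ideal R) (q : ℕ) : Ideal R :=
  Ideal.span ((fun a => a ^ q) '' (J : Set R))

/-! ### Powers of ideals -/

theorem Finset.sup_pow_mul_card_succ_le {R ι : Type*} [CommRing R] [DecidableEq ι]
    (s : Finset ι) (I : ι → Ideal R) (q : ℕ) :
    (s.sup I) ^ (q * s.card + 1) ≤ s.sup fun i => I i ^ q := by
  induction s using Finset.induction_on with
  | empty => simp
  | insert a s ha ih =>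
    rw [Finset.card_insert_of_notMem ha, Finset.sup_insert, Finset.sup_insert,
      show q * (s.card + 1) + 1 = q + (q * s.card + 1) by ring]
    exact Ideal.sup_pow_add_le_pow_sup_pow.trans (sup_le_sup_left ih _)

theorem Ideal.span_image_pow_le {R ι : Type*} [CommRing R] (s : Finset ι) (x : ι → R) (q N : ℕ)
    (hN : q * s.card < N) :
    Ideal.span (x '' s) ^ N ≤ Ideal.span ((fun i => x i ^ q) '' s) := by
  classical
  have h : ∀ y : ι → R, Ideal.span (y '' s) = s.sup fun i => Ideal.span {y i} := by
    intro y
    rw [Finset.sup_eq_iSup, ← Set.biUnion_of_singleton (y '' s), Set.biUnion_image]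
    exact Submodule.span_iUnion₂ _
  refine (Ideal.pow_le_pow_right hN).trans ?_
  rw [h, h]
  simpa only [Ideal.span_singleton_pow] using Finset.sup_pow_mul_card_succ_le s
    (fun i => Ideal.span {x i}) q

/-! ### Determinants of perturbed matrices of low rank -/

/-- If `P` factors through rank `k` and the entries of `U` lie in `E`, then the determinant of
`P + U` of size `t` lies in `E ^ (t - k)`. -/
theorem Matrix.det_add_mul_mem_pow {A : Type*} [CommRing A] {t k : ℕ} (E : Ideal A)
    (U : Matrix (Fin t) (Fin t) A) (Y : Matrix (Fin t) (Fin k) A) (Z : Matrix (Fin k) (Fin t) A)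
    (hU : ∀ i j, U i j ∈ E) : (U + Y * Z).det ∈ E ^ (t - k) := by
  have h : (U + Y * Z).det = (Matrix.fromBlocks 1 (-Z) Y U).det := by
    rw [Matrix.det_fromBlocks_one₁₁]; simp
  rw [h, Matrix.det_apply]
  refine Ideal.sum_mem _ fun σ _ => ?_
  rw [Units.smul_def, zsmul_eq_mul]
  refine Ideal.mul_mem_left _ _ ?_
  rw [← Equiv.prod_comp σ.symm]
  simp only [Equiv.apply_symm_apply]
  rw [Fintype.prod_sum_type]
  refine Ideal.mul_mem_left _ _ ?_
  set S : Finset (Fin t) := Finset.univ.filter fun i => (σ.symm (Sum.inr i)).isRight with hS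
  have hcard : t - k ≤ S.card := by
    have h1 : (Finset.univ.filter fun i : Fin t => ¬ (σ.symm (Sum.inr i)).isRight).card ≤ k := by
      have : (Finset.univ.filter fun i : Fin t => ¬ (σ.symm (Sum.inr i)).isRight).card ≤
          ((Finset.univ : Finset (Fin k)).map
            ⟨(Sum.inl : Fin k → Fin k ⊕ Fin t), Sum.inl_injective⟩).card := by
        refine Finset.card_le_card_of_injOn (fun i => σ.symm (Sum.inr i)) ?_ ?_
        · intro i hi
          simp only [Finset.coe_filter, Set.mem_ofPred_eq, Finset.mem_univ, true_and] at hi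
          rcases h : σ.symm (Sum.inr i) with a | b
          · simp [h]
          · simp [h] at hi
        · intro i _ j _ hij
          simpa using hij
      simpa using this
    have h2 := Finset.card_filter_add_card_filter_not (s := (Finset.univ : Finset (Fin t)))
      (fun i : Fin t => (σ.symm (Sum.inr i)).isRight = true)
    rw [← hS, Finset.card_univ, Fintype.card_fin] at h2
    omega
  rw [← Finset.prod_mul_prod_compl S]
  refine Ideal.mul_mem_right _ _ (Ideal.pow_le_pow_right hcard ?_)
  rw [← Finset.prod_const]
  refine Ideal.prod_mem_prod fun i hi => ?_
  simp only [hS, Finset.mem_filter, Finset.mem_univ, true_and] at hi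
  rcases h : σ.symm (Sum.inr i) with a | b
  · simp [h] at hi
  · simpa [h] using hU _ _

/-! ### Flatness of Frobenius over the prime field -/

namespace MvPolynomial

variable {σ : Type*} {p : ℕ}

/-- The coefficient of `x ^ a` of a polynomial written in terms of `q`-th powers of the
variables. -/
noncomputable def frobeniusComponent (F : Type*) [Field F] (q : ℕ) (a : σ →₀ ℕ) :
    MvPolynomial σ F →ₗ[F] MvPolynomial σ F :=
  open Classical in
  (basisMonomials σ F).constr F fun w =>
    if w.mapRange (· % q) (Nat.zero_mod q) = a then
      monomial (w.mapRange (· / q) (Nat.zero_div q)) 1 else 0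

open Classical in
theorem frobeniusComponent_monomial (F : Type*) [Field F] (q : ℕ) (a w : σ →₀ ℕ) :
    frobeniusComponent F q a (monomial w 1) =
      if w.mapRange (· % q) (Nat.zero_mod q) = a then
        monomial (w.mapRange (· / q) (Nat.zero_div q)) 1 else 0 := by
  have := congrFun (coe_basisMonomials σ F) w
  rw [← this, frobeniusComponent, Module.Basis.constr_basis]

theorem frobeniusComponent_expand_mul (F : Type*) [Field F] {q : ℕ} (hq : 0 < q) (a : σ →₀ ℕ)
    (h g : MvPolynomial σ F) :
    frobeniusComponent F q a (expand q h * g) = h * frobeniusComponent F q a g := by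
  classical
  have key : ((LinearMap.mul F _).comp (expand q).toLinearMap).compr₂ (frobeniusComponent F q a) =
      (LinearMap.mul F (MvPolynomial σ F)).compl₂ (frobeniusComponent F q a) := by
    refine (basisMonomials σ F).ext fun v => (basisMonomials σ F).ext fun w => ?_
    have hmod : (q • v + w).mapRange (· % q) (Nat.zero_mod q) =
        w.mapRange (· % q) (Nat.zero_mod q) := by
      ext i; simp
    have hdiv : (q • v + w).mapRange (· / q) (Nat.zero_div q) =
        v + w.mapRange (· / q) (Nat.zero_div q) := by
      ext i; simp [Nat.mul_add_div hq]
    simp only [coe_basisMonomials, LinearMap.compr₂_apply, LinearMap.comp_apply,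
      LinearMap.mul_apply', AlgHom.toLinearMap_apply, LinearMap.compl₂_apply, expand_monomial,
      monomial_mul, one_mul, frobeniusComponent_monomial, hmod, hdiv]
    split_ifs <;> simp [monomial_mul]
  simpa using LinearMap.congr_fun₂ key h g

theorem sum_monomial_mul_expand_frobeniusComponent (F : Type*) [Field F] (q : ℕ)
    (f : MvPolynomial σ F) (S : Finset (σ →₀ ℕ))
    (hS : ∀ w : σ →₀ ℕ, w.mapRange (· % q) (Nat.zero_mod q) ∈ S) :
    ∑ a ∈ S, monomial a 1 * expand q (frobeniusComponent F q a f) = f := by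
  classical
  have key : ∑ a ∈ S, (LinearMap.mulLeft F (monomial a (1 : F))).comp
      ((expand q).toLinearMap.comp (frobeniusComponent F q a)) = LinearMap.id := by
    refine (basisMonomials σ F).ext fun w => ?_
    simp only [coe_basisMonomials, LinearMap.sum_apply, LinearMap.comp_apply,
      LinearMap.mulLeft_apply, AlgHom.toLinearMap_apply, LinearMap.id_apply,
      frobeniusComponent_monomial, apply_ite (expand q), map_zero, mul_ite, mul_zero,
      Finset.sum_ite_eq, hS, if_true, expand_monomial, monomial_mul, mul_one]
    congr 2
    ext i
    simp [Nat.mod_add_div]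
  simpa using LinearMap.congr_fun key f

theorem exists_finset_mapRange_mod_mem [Finite σ] {q : ℕ} (hq : 0 < q) :
    ∃ S : Finset (σ →₀ ℕ), ∀ w : σ →₀ ℕ, w.mapRange (· % q) (Nat.zero_mod q) ∈ S := by
  refine ⟨(Finsupp.finite_of_degree_le (σ := σ) (Nat.card σ * q)).toFinset, fun w => ?_⟩
  have := Fintype.ofFinite σ
  rw [Set.Finite.mem_toFinset, Set.mem_ofPred_eq, Finsupp.degree_eq_sum, Nat.card_eq_fintype_card]
  calc _ ≤ ∑ _ : σ, q := Finset.sum_le_sum fun i _ => by simpa using (Nat.mod_lt _ hq).le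
    _ = _ := by simp

theorem expand_zmod_pow [Fact p.Prime] (e : ℕ) (f : MvPolynomial σ (ZMod p)) :
    expand (p ^ e) f = f ^ p ^ e := by
  induction e with
  | zero => simp
  | succ e ih => rw [pow_succ', expand_mul, ih, expand_zmod, ← pow_mul, mul_comm]

/-- Over the prime field, an element of a polynomial ring that is regular modulo `J` has its
Frobenius powers regular modulo the bracket powers of `J`. -/
theorem mem_bracketPow_of_pow_mul_mem [Finite σ] [Fact p.Prime] (e : ℕ)
    (J : Ideal (MvPolynomial σ (ZMod p))) (d f : MvPolynomial σ (ZMod p))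
    (hd : ∀ g, d * g ∈ J → g ∈ J) (h : d ^ p ^ e * f ∈ bracketPow J (p ^ e)) :
    f ∈ bracketPow J (p ^ e) := by
  have hq : 0 < p ^ e := pow_pos (Fact.out : p.Prime).pos e
  have hcomp : ∀ x ∈ bracketPow J (p ^ e), ∀ r a,
      frobeniusComponent (ZMod p) (p ^ e) a (r * x) ∈ J := by
    intro x hx
    refine Submodule.span_induction ?_ ?_ ?_ ?_ hx
    · rintro _ ⟨y, hy, rfl⟩ r a
      simp only
      rw [← expand_zmod_pow, mul_comm, frobeniusComponent_expand_mul _ hq]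
      exact J.mul_mem_right _ hy
    · simp
    · intro x y _ _ hx hy r a
      rw [mul_add, map_add]
      exact J.add_mem (hx r a) (hy r a)
    · intro s x _ hx r a
      rw [smul_eq_mul, ← mul_assoc]
      exact hx _ a
  obtain ⟨S, hS⟩ := exists_finset_mapRange_mod_mem (σ := σ) hq
  rw [← sum_monomial_mul_expand_frobeniusComponent (ZMod p) (p ^ e) f S hS]
  refine Ideal.sum_mem _ fun a _ => Ideal.mul_mem_left _ _ ?_
  rw [expand_zmod_pow]
  refine Ideal.subset_span ⟨_, hd _ ?_, rfl⟩
  have := hcomp _ h 1 a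
  rwa [one_mul, ← expand_zmod_pow, frobeniusComponent_expand_mul _ hq] at this

end MvPolynomial

/-! ### Localization at a minor of size `k` -/

/-- The leading minor of size `k` of the generic matrix. -/
noncomputable def leadingMinor (F : Type*) [Field F] {m n k : ℕ} (hkm : k ≤ m) (hkn : k ≤ n) :
    MvPolynomial (Fin m × Fin n) F :=
  ((genMat F m n).submatrix (Fin.castLE hkm) (Fin.castLE hkn)).det

theorem borderedMinor_mem_minorsIdeal (F : Type*) [Field F] {m n k : ℕ} (hkm : k ≤ m)
    (hkn : k ≤ n) {i : Fin m} {j : Fin n} (hi : k ≤ i) (hj : k ≤ j) :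
    ((genMat F m n).submatrix (Sum.elim (Fin.castLE hkm) fun _ : Fin 1 => i)
      (Sum.elim (Fin.castLE hkn) fun _ : Fin 1 => j)).det ∈ minorsIdeal F m n (k + 1) := by
  refine Ideal.subset_span
    ⟨fun a => if h : (a : ℕ) < k then ⟨a, by omega⟩ else i,
      fun a => if h : (a : ℕ) < k then ⟨a, by omega⟩ else j, ?_, ?_, ?_⟩
  · intro a b hab
    have := a.2
    have := b.2
    simp only [Fin.lt_def] at hab ⊢
    split_ifs <;> (try simp only) <;> omega
  · intro a b hab
    have := a.2
    have := b.2
    simp only [Fin.lt_def] at hab ⊢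
    split_ifs <;> (try simp only) <;> omega
  · rw [← Matrix.det_submatrix_equiv_self finSumFinEquiv, Matrix.submatrix_submatrix]
    congr 2 <;>
    · ext (a | a)
      · simp [Fin.castLE]
      · simp

/-- A matrix whose leading minor of size `k` is a unit is the sum of a matrix factoring through
rank `k` and a Schur complement, whose entries are bordered minors up to a unit. -/
theorem Matrix.exists_eq_add_mul_of_isUnit_det {A : Type*} [CommRing A] {m n k : ℕ} (hkm : k ≤ m)
    (hkn : k ≤ n) (X : Matrix (Fin m) (Fin n) A)
    (hD : IsUnit (X.submatrix (Fin.castLE hkm) (Fin.castLE hkn)).det) :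
    ∃ (U : Matrix (Fin m) (Fin n) A) (Y : Matrix (Fin m) (Fin k) A) (Z : Matrix (Fin k) (Fin n) A),
      X = U + Y * Z ∧
      (∀ i j, (X.submatrix (Fin.castLE hkm) (Fin.castLE hkn)).det * U i j =
        (X.submatrix (Sum.elim (Fin.castLE hkm) fun _ : Fin 1 => i)
          (Sum.elim (Fin.castLE hkn) fun _ : Fin 1 => j)).det) ∧
      ∀ (i : Fin m) (j : Fin n), ¬ (k ≤ (i : ℕ) ∧ k ≤ (j : ℕ)) → U i j = 0 := by
  set D := X.submatrix (Fin.castLE hkm) (Fin.castLE hkn) with hDdef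
  have : Invertible D := D.invertibleOfIsUnitDet hD
  let Y : Matrix (Fin m) (Fin k) A := X.submatrix id (Fin.castLE hkn) * ⅟D
  let Z : Matrix (Fin k) (Fin n) A := X.submatrix (Fin.castLE hkm) id
  have hU : ∀ i j, D.det * (X - Y * Z) i j =
      (X.submatrix (Sum.elim (Fin.castLE hkm) fun _ : Fin 1 => i)
        (Sum.elim (Fin.castLE hkn) fun _ : Fin 1 => j)).det := by
    intro i j
    have : X.submatrix (Sum.elim (Fin.castLE hkm) fun _ : Fin 1 => i)
        (Sum.elim (Fin.castLE hkn) fun _ : Fin 1 => j) =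
        Matrix.fromBlocks D (X.submatrix (Fin.castLE hkm) fun _ => j)
          (X.submatrix (fun _ => i) (Fin.castLE hkn)) (X.submatrix (fun _ => i) fun _ => j) := by
      ext (a | a) (b | b) <;> rfl
    rw [this, Matrix.det_fromBlocks₁₁, Matrix.det_fin_one]
    rfl
  refine ⟨X - Y * Z, Y, Z, by simp, hU, fun i j hij => ?_⟩
  refine (hD.mul_right_eq_zero).1 ?_
  rw [hU]
  by_cases hi : k ≤ (i : ℕ)
  · exact Matrix.det_zero_of_column_eq (i := Sum.inl ⟨j, by omega⟩) (j := Sum.inr 0) (by simp)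
      fun a => rfl
  · exact Matrix.det_zero_of_row_eq (i := Sum.inl ⟨i, by omega⟩) (j := Sum.inr 0) (by simp) rfl

theorem map_minorsIdeal_pow_le_map_bracketPow (F : Type*) [Field F] {m n k : ℕ}
    (hkm : k ≤ m) (hkn : k ≤ n) {t q L : ℕ} (hL : q * ((m - k) * (n - k)) < (t - k) * L)
    {A : Type*} [CommRing A] (φ : MvPolynomial (Fin m × Fin n) F →+* A)
    (hφ : IsUnit (φ (leadingMinor F hkm hkn))) :
    (minorsIdeal F m n t).map φ ^ L ≤ (bracketPow (minorsIdeal F m n (k + 1)) q).map φ := by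
  rw [leadingMinor, RingHom.map_det] at hφ
  obtain ⟨U, Y, Z, hX, hU, hU₀⟩ :=
    Matrix.exists_eq_add_mul_of_isUnit_det hkm hkn ((genMat F m n).map φ) hφ
  let x : Fin (m - k) × Fin (n - k) → A := fun a =>
    U ⟨k + a.1, by omega⟩ ⟨k + a.2, by omega⟩
  let E : Ideal A := Ideal.span (x '' (Finset.univ : Finset (Fin (m - k) × Fin (n - k))))
  have hUE : ∀ i j, U i j ∈ E := by
    intro i j
    by_cases hij : k ≤ (i : ℕ) ∧ k ≤ (j : ℕ)
    · refine Ideal.subset_span ⟨(⟨i - k, by omega⟩, ⟨j - k, by omega⟩), by simp, ?_⟩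
      simp only [x]
      congr 1 <;> ext <;> simp only <;> omega
    · rw [hU₀ i j hij]
      exact E.zero_mem
  have hIt : (minorsIdeal F m n t).map φ ≤ E ^ (t - k) := by
    rw [minorsIdeal, Ideal.map_span, Ideal.span_le]
    rintro _ ⟨_, ⟨row, col, -, -, rfl⟩, rfl⟩
    have : φ.mapMatrix ((genMat F m n).submatrix row col) =
        U.submatrix row col + Y.submatrix row id * Z.submatrix id col := by
      rw [← Matrix.submatrix_mul Y Z row id col Function.bijective_id]
      exact congrArg (fun M => M.submatrix row col) hX
    rw [SetLike.mem_coe, RingHom.map_det, this]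
    exact Matrix.det_add_mul_mem_pow E _ _ _ fun i j => hUE _ _
  refine (Ideal.pow_right_mono hIt L).trans ?_
  rw [← pow_mul]
  refine (Ideal.span_image_pow_le _ x q _ (by simpa using hL)).trans ?_
  rw [Ideal.span_le]
  rintro _ ⟨a, -, rfl⟩
  refine (Ideal.unit_mul_mem_iff_mem _ (hφ.pow q)).1 ?_
  have hmap : φ.mapMatrix ((genMat F m n).submatrix (Fin.castLE hkm) (Fin.castLE hkn)) =
    ((genMat F m n).map φ).submatrix (Fin.castLE hkm) (Fin.castLE hkn) := rfl
  simp only [x]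
  rw [← mul_pow, hmap, hU, Matrix.submatrix_map, ← RingHom.mapMatrix_apply, ← RingHom.map_det,
    ← map_pow]
  exact Ideal.mem_map_of_mem _ (Ideal.subset_span
    ⟨_, borderedMinor_mem_minorsIdeal F hkm hkn (by simp) (by simp), rfl⟩)

/-- After multiplication by a power of the leading minor of size `k`, large powers of `I_t` lie in
the bracket powers of `I_{k+1}`. -/
theorem exists_leadingMinor_pow_mul_mem_bracketPow (F : Type*) [Field F] {m n k : ℕ}
    (hkm : k ≤ m) (hkn : k ≤ n) {t q L : ℕ} (hL : q * ((m - k) * (n - k)) < (t - k) * L)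
    {f : MvPolynomial (Fin m × Fin n) F} (hf : f ∈ minorsIdeal F m n t ^ L) :
    ∃ M : ℕ, leadingMinor F hkm hkn ^ M * f ∈ bracketPow (minorsIdeal F m n (k + 1)) q := by
  let A := Localization.Away (leadingMinor F hkm hkn)
  have hmap := map_minorsIdeal_pow_le_map_bracketPow F hkm hkn hL
    (algebraMap (MvPolynomial (Fin m × Fin n) F) A)
    (IsLocalization.Away.algebraMap_isUnit _)
  rw [← Ideal.map_pow] at hmap
  obtain ⟨⟨a, s⟩, has⟩ := (IsLocalization.mem_map_algebraMap_iff
    (Submonoid.powers (leadingMinor F hkm hkn)) A).1 (hmap (Ideal.mem_map_of_mem _ hf))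
  rw [← map_mul] at has
  obtain ⟨c, hc⟩ := (IsLocalization.eq_iff_exists
    (Submonoid.powers (leadingMinor F hkm hkn)) A).1 has
  obtain ⟨M, hM⟩ := (c * s).2
  refine ⟨M, ?_⟩
  simp only at hM hc
  rw [hM, Submonoid.coe_mul, mul_assoc, mul_comm (s : MvPolynomial (Fin m × Fin n) F), hc]
  exact Ideal.mul_mem_left _ _ a.2

/-! ### Diagonal weights -/

/-- A weight on the entries of an `m × n` matrix for which the main diagonal of every minor has
larger weight than its other terms, and which separates monomials with exponents less than `b`. -/
def diagWeight (m n b : ℕ) (x : Fin m × Fin n) : ℕ :=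
  b ^ (n * m) + b ^ (n * (x.1 : ℕ) + x.2)

theorem eq_of_weight_diagWeight_eq {m n b : ℕ} {u v : Fin m × Fin n →₀ ℕ}
    (hu : ∀ x, u x < b) (hv : ∀ x, v x < b)
    (h : Finsupp.weight (diagWeight m n b) u = Finsupp.weight (diagWeight m n b) v) : u = v := by
  have key : ∀ (u : Fin m × Fin n →₀ ℕ) (hu : ∀ x, u x < b),
      Finsupp.weight (diagWeight m n b) u = (∑ x, u x) * b ^ (m * n) +
        finFunctionFinEquiv fun a => (⟨u (finProdFinEquiv.symm a), hu _⟩ : Fin b) := by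
    intro u hu
    rw [Finsupp.weight_apply, Finsupp.sum_fintype _ _ (by simp), finFunctionFinEquiv_apply,
      ← Equiv.sum_comp finProdFinEquiv, Finset.sum_mul, ← Finset.sum_add_distrib]
    refine Finset.sum_congr rfl fun x _ => ?_
    simp only [diagWeight, smul_eq_mul, Equiv.symm_apply_apply, finProdFinEquiv_apply_val]
    rw [mul_add, mul_comm n m, add_comm (x.2 : ℕ)]
  rw [key u hu, key v hv] at h
  have h' := congrArg (· % b ^ (m * n)) h
  simp only [Nat.mul_add_mod_self_right, Nat.mod_eq_of_lt (Fin.is_lt _)] at h'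
  have h'' := finFunctionFinEquiv.injective (Fin.ext h')
  ext x
  have := congrFun h'' (finProdFinEquiv x)
  simpa using this

theorem sum_diagWeight_perm_lt {m n b s : ℕ} (hb : 2 ≤ b) {row : Fin s → Fin m}
    {col : Fin s → Fin n}
    (hrow : StrictMono row) (hcol : StrictMono col) {σ : Equiv.Perm (Fin s)} (hσ : σ ≠ 1) :
    ∑ a, diagWeight m n b (row (σ a), col a) < ∑ a, diagWeight m n b (row a, col a) := by
  simp only [diagWeight, Finset.sum_add_distrib]
  refine Nat.add_lt_add_left ?_ _
  obtain ⟨c, hc, hmax⟩ := (Finset.univ.filter fun a => σ a ≠ a).exists_max_image id (by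
    obtain ⟨a, ha⟩ := not_forall.1 fun h => hσ (Equiv.ext h)
    exact ⟨a, by simpa using ha⟩)
  simp only [Finset.mem_filter, Finset.mem_univ, true_and, id] at hc hmax
  have hfix : ∀ a, c < a → σ a = a := fun a ha => by
    by_contra h
    exact absurd (hmax a h) (not_le.2 ha)
  have hle : ∀ a, a ≤ c → σ a ≤ c := fun a ha => by
    by_contra h
    have := σ.injective (hfix (σ a) (not_le.1 h))
    exact h (this.le.trans ha)
  rw [← Finset.sum_filter_add_sum_filter_not Finset.univ (· ≤ c),
    ← Finset.sum_filter_add_sum_filter_not Finset.univ (· ≤ c)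
      (fun a => b ^ (n * (row a : ℕ) + col a))]
  refine add_lt_add_of_lt_of_le ?_ (Finset.sum_le_sum fun a ha => ?_)
  · have hinj : Set.InjOn (fun a => n * (row (σ a) : ℕ) + col a)
        (Finset.univ.filter (· ≤ c) : Finset (Fin s)) := by
      intro a _ a' _ haa
      have h := congrArg (· % n) haa
      simp only [Nat.mul_add_mod_self_left, Nat.mod_eq_of_lt (Fin.is_lt _)] at h
      exact hcol.injective (Fin.ext h)
    rw [← Finset.sum_image (f := fun e => b ^ e) hinj]
    refine (Nat.geomSum_lt (n := n * (row c : ℕ) + col c) hb ?_).trans_le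
      (Finset.single_le_sum (f := fun a => b ^ (n * (row a : ℕ) + col a))
        (fun _ _ => Nat.zero_le _) (by simp))
    intro e he
    simp only [Finset.mem_image, Finset.mem_filter, Finset.mem_univ, true_and] at he
    obtain ⟨a, ha, rfl⟩ := he
    rcases (hle a ha).lt_or_eq with h | h
    · have h1 : (row (σ a) : ℕ) + 1 ≤ row c := hrow h
      have h2 := (col a).2
      have h3 := Nat.mul_le_mul_left n h1
      rw [Nat.mul_add] at h3
      omega
    · have h1 : a < c := lt_of_le_of_ne ha (by rintro rfl; exact hc h)
      have h2 : (col a : ℕ) < col c := hcol h1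
      rw [h]
      omega
  · simp only [Finset.mem_filter, Finset.mem_univ, true_and, not_le] at ha
    rw [hfix a ha]

/-- On a set without strictly increasing pairs, a diagonal weight is the sum of a function of the
row and a function of the column, which bounds the weight from below elsewhere. -/
theorem exists_add_le_diagWeight {m n b : ℕ} (hb : 1 ≤ b) (A : Finset (Fin m × Fin n))
    (hA : ∀ x ∈ A, ∀ y ∈ A, ¬ (x.1 < y.1 ∧ x.2 < y.2)) :
    ∃ (α : Fin m → ℕ) (β : Fin n → ℕ), (∀ i j, α i + β j ≤ diagWeight m n b (i, j)) ∧
      ∀ x ∈ A, α x.1 + β x.2 = diagWeight m n b x := by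
  have hc : ∀ i : ℕ, ∃ c : ℕ, c ≤ n ∧
      ∀ x ∈ A, ((x.1 : ℕ) ≤ i → c ≤ x.2) ∧ (i < x.1 → (x.2 : ℕ) ≤ c) := by
    intro i
    by_cases h : (A.filter fun x => (x.1 : ℕ) ≤ i).Nonempty
    · obtain ⟨y, hy, hmin⟩ := Finset.exists_min_image _ (fun x => (x.2 : ℕ)) h
      rw [Finset.mem_filter] at hy
      refine ⟨y.2, y.2.2.le, fun x hx => ⟨fun hxi => hmin x (by simp [hx, hxi]), fun hxi => ?_⟩⟩
      by_contra hlt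
      exact hA y hy.1 x hx ⟨Fin.lt_def.2 (by omega), Fin.lt_def.2 (by omega)⟩
    · refine ⟨n, le_rfl, fun x hx => ⟨fun hxi => ?_, fun _ => x.2.2.le⟩⟩
      exact absurd ⟨x, by simp [hx, hxi]⟩ h
  choose c hcn hc using hc
  set α : ℕ → ℕ := fun i => ∑ a ∈ Finset.range i, (b ^ n - 1) * b ^ (n * a) * b ^ c a with hα
  have hbn : 1 ≤ b ^ n := Nat.one_le_pow _ _ hb
  have hαs : ∀ i, α (i + 1) = α i + (b ^ n - 1) * b ^ (n * i) * b ^ c i := fun i =>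
    Finset.sum_range_succ _ _
  have hVs : ∀ i j, b ^ (n * (i + 1) + j) =
      b ^ (n * i + j) + (b ^ n - 1) * b ^ (n * i) * b ^ j := by
    intro i j
    obtain ⟨d, hd⟩ := Nat.exists_eq_add_of_le hbn
    rw [mul_add, mul_one, pow_add, pow_add, pow_add, hd, Nat.add_sub_cancel_left]
    ring
  have hαle : ∀ i, α i ≤ b ^ (n * i + n) := by
    intro i
    induction i with
    | zero => simp [hα]
    | succ i ih =>
      rw [hαs, hVs]
      exact add_le_add ih (Nat.mul_le_mul_left _ (Nat.pow_le_pow_right hb (hcn i)))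
  have hαC : ∀ i : Fin m, α i ≤ b ^ (n * m) := fun i => by
    refine (hαle i).trans (Nat.pow_le_pow_right hb ?_)
    rw [← Nat.mul_succ]
    exact Nat.mul_le_mul_left _ i.2
  have hmin : ∀ x ∈ A, ∀ i : ℕ,
      b ^ (n * (x.1 : ℕ) + x.2) + α i ≤ b ^ (n * i + x.2) + α x.1 := by
    intro x hx i
    rcases le_total (x.1 : ℕ) i with h | h
    · induction i, h using Nat.le_induction with
      | base => rfl
      | succ i hi ih =>
        rw [hαs, hVs]
        have := Nat.mul_le_mul_left ((b ^ n - 1) * b ^ (n * i))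
          (Nat.pow_le_pow_right hb ((hc i x hx).1 hi))
        omega
    · induction h using Nat.decreasingInduction with
      | self => rfl
      | of_succ i hi ih =>
        rw [hαs, hVs] at ih
        have := Nat.mul_le_mul_left ((b ^ n - 1) * b ^ (n * i))
          (Nat.pow_le_pow_right hb ((hc i x hx).2 hi))
        omega
  have hβ : ∀ j : Fin n, ∃ β : ℕ, (∀ i : Fin m, α i + β ≤ diagWeight m n b (i, j)) ∧
      ∀ i, (i, j) ∈ A → α i + β = diagWeight m n b (i, j) := by
    intro j
    rcases isEmpty_or_nonempty (Fin m) with _ | _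
    · exact ⟨0, fun i => isEmptyElim i, fun i => isEmptyElim i⟩
    · obtain ⟨i₀, -, h₀⟩ := Finset.exists_min_image (Finset.univ : Finset (Fin m))
        (fun i => diagWeight m n b (i, j) - α i) Finset.univ_nonempty
      refine ⟨diagWeight m n b (i₀, j) - α i₀, fun i => ?_, fun i hi => ?_⟩
      · have := h₀ i (Finset.mem_univ _)
        have := hαC i
        have := hαC i₀
        simp only [diagWeight] at *
        omega
      · have := h₀ i (Finset.mem_univ _)
        have := hmin _ hi i₀
        have := hαC i
        have := hαC i₀
        simp only [diagWeight] at *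
        omega
  choose β hβ₁ hβ₂ using hβ
  exact ⟨fun i => α i, β, fun i j => hβ₁ j i, fun x hx => hβ₂ x.2 x.1 hx⟩

/-- A finite set without chains of length `k + 1` is covered by `k` antichains. -/
theorem exists_antichain_labelling {P : Type*} (r : P → P → Prop) (k : ℕ) (A : Finset P)
    (hA : ¬ ∃ c : Fin (k + 1) → P, (∀ a, c a ∈ A) ∧ ∀ a : Fin k, r (c a.castSucc) (c a.succ)) :
    ∃ lab : P → ℕ, (∀ x ∈ A, lab x < k) ∧ ∀ x ∈ A, ∀ y ∈ A, lab x = lab y → ¬ r x y := by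
  classical
  induction k generalizing A with
  | zero =>
    have : A = ∅ := by
      rw [Finset.eq_empty_iff_forall_notMem]
      exact fun x hx => hA ⟨fun _ => x, fun _ => hx, fun a => a.elim0⟩
    exact ⟨fun _ => 0, by simp [this], by simp [this]⟩
  | succ k ih =>
    obtain ⟨lab, h₁, h₂⟩ := ih (A.filter fun x => ∃ y ∈ A, r y x) (by
      rintro ⟨c, hc, hr⟩
      obtain ⟨y, hyA, hy⟩ := (Finset.mem_filter.1 (hc 0)).2
      refine hA ⟨Fin.cons y c, fun a => ?_, fun a => ?_⟩
      · refine Fin.cases ?_ (fun a => ?_) a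
        · simpa using hyA
        · simpa using (Finset.mem_filter.1 (hc a)).1
      · refine Fin.cases ?_ (fun a => ?_) a
        · simpa using hy
        · simpa using hr a)
    refine ⟨fun x => if ∃ y ∈ A, r y x then lab x + 1 else 0, fun x hx => ?_,
      fun x hx y hy hxy hr => ?_⟩
    · dsimp only
      split_ifs with h
      · have := h₁ x (Finset.mem_filter.2 ⟨hx, h⟩)
        omega
      · omega
    · have hy' : ∃ z ∈ A, r z y := ⟨x, hx, hr⟩
      dsimp only at hxy
      rw [if_pos hy'] at hxy
      split_ifs at hxy with hx'
      exact h₂ x (Finset.mem_filter.2 ⟨hx, hx'⟩) y (Finset.mem_filter.2 ⟨hy, hy'⟩)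
        (by omega) hr

/-! ### The ideal of minors is the ideal of the matrices of bounded rank -/

theorem Polynomial.coeff_prod_sum_of_natDegree_le {ι B : Type*} [CommRing B] (s : Finset ι)
    (f : ι → Polynomial B) (d : ι → ℕ) (h : ∀ i ∈ s, (f i).natDegree ≤ d i) :
    (∏ i ∈ s, f i).coeff (∑ i ∈ s, d i) = ∏ i ∈ s, (f i).coeff (d i) := by
  classical
  induction s using Finset.induction_on with
  | empty => simp
  | insert a s ha ih =>
    rw [Finset.prod_insert ha, Finset.sum_insert ha, Finset.prod_insert ha,
      ← ih fun i hi => h i (Finset.mem_insert_of_mem hi)]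
    refine Polynomial.coeff_mul_add_eq_of_natDegree_le (h a (Finset.mem_insert_self _ _)) ?_
    exact (Polynomial.natDegree_prod_le _ _).trans (Finset.sum_le_sum fun i hi =>
      h i (Finset.mem_insert_of_mem hi))

/-- Substitution of the product of two generic matrices of sizes `m × k` and `k × n` for the
generic `m × n` matrix. -/
noncomputable def genProd (F : Type*) [Field F] (m n k : ℕ) :
    MvPolynomial (Fin m × Fin n) F →ₐ[F] MvPolynomial (Fin m × Fin k ⊕ Fin k × Fin n) F :=
  aeval fun x => ∑ a, X (Sum.inl (x.1, a)) * X (Sum.inr (a, x.2))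

theorem minorsIdeal_le_ker_genProd (F : Type*) [Field F] (m n k : ℕ) :
    minorsIdeal F m n (k + 1) ≤ RingHom.ker (genProd F m n k) := by
  rw [minorsIdeal, Ideal.span_le]
  rintro _ ⟨row, col, -, -, rfl⟩
  rw [SetLike.mem_coe, RingHom.mem_ker, AlgHom.map_det]
  have h := Matrix.det_add_mul_mem_pow (⊥ : Ideal (MvPolynomial (Fin m × Fin k ⊕ Fin k × Fin n) F))
    (0 : Matrix (Fin (k + 1)) (Fin (k + 1)) _)
    (Matrix.of fun i a => X (Sum.inl (row i, a))) (Matrix.of fun a j => X (Sum.inr (a, col j)))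
    (by simp)
  rw [zero_add, Nat.add_sub_cancel_left, pow_one, Ideal.mem_bot] at h
  rw [← h]
  congr 1
  ext i j : 2
  simp [genMat, genProd, Matrix.mul_apply]

theorem genProd_leadingMinor_ne_zero (F : Type*) [Field F] {m n k : ℕ} (hkm : k ≤ m)
    (hkn : k ≤ n) : genProd F m n k (leadingMinor F hkm hkn) ≠ 0 := by
  intro h
  let ε : MvPolynomial (Fin m × Fin k ⊕ Fin k × Fin n) F →ₐ[F] F :=
    aeval (Sum.elim (fun x => if (x.1 : ℕ) = x.2 then 1 else 0)
      fun x => if (x.1 : ℕ) = x.2 then 1 else 0)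
  have h1 := congrArg ε h
  rw [leadingMinor, AlgHom.map_det, AlgHom.map_det, map_zero] at h1
  refine one_ne_zero (α := F) ?_
  rw [← h1, ← Matrix.det_one (n := Fin k)]
  congr 1
  ext i j
  simp [genMat, genProd, ε, Matrix.one_apply, Fin.val_inj]

/-- If the leading monomial of a polynomial vanishing on the matrices of rank at most `k` is taken
with respect to a diagonal weight, then it is divisible by the main diagonal of a `k + 1`-minor. -/
theorem exists_diagonal_of_genProd_eq_zero {F : Type*} [Field F] {m n k b : ℕ} (hb : 1 ≤ b)
    {f : MvPolynomial (Fin m × Fin n) F} (hf : genProd F m n k f = 0)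
    {u : Fin m × Fin n →₀ ℕ} (hu : u ∈ f.support)
    (hlt : ∀ v ∈ f.support, v ≠ u →
      Finsupp.weight (diagWeight m n b) v < Finsupp.weight (diagWeight m n b) u) :
    ∃ (row : Fin (k + 1) → Fin m) (col : Fin (k + 1) → Fin n), StrictMono row ∧ StrictMono col ∧
      ∀ a, (row a, col a) ∈ u.support := by
  classical
  by_contra hno
  obtain ⟨lab, hlab, hanti⟩ := exists_antichain_labelling
    (fun x y : Fin m × Fin n => x.1 < y.1 ∧ x.2 < y.2) k u.support (by
      rintro ⟨c, hc, hr⟩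
      exact hno ⟨fun a => (c a).1, fun a => (c a).2, Fin.strictMono_iff_lt_succ.2 fun a => (hr a).1,
        Fin.strictMono_iff_lt_succ.2 fun a => (hr a).2, hc⟩)
  have hpot : ∀ a : Fin k, ∃ (α : Fin m → ℕ) (β : Fin n → ℕ),
      (∀ i j, α i + β j ≤ diagWeight m n b (i, j)) ∧
      ∀ x ∈ u.support.filter (fun x => lab x = a), α x.1 + β x.2 = diagWeight m n b x := fun a =>
    exists_add_le_diagWeight hb _ fun x hx y hy => by
      rw [Finset.mem_filter] at hx hy
      exact hanti x hx.1 y hy.1 (hx.2.trans hy.2.symm)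
  choose α β hle heq using hpot
  let Ψ : MvPolynomial (Fin m × Fin k ⊕ Fin k × Fin n) F →ₐ[F]
      Polynomial (MvPolynomial (Fin m × Fin k ⊕ Fin k × Fin n) F) := aeval (Sum.elim
    (fun x => Polynomial.monomial (α x.2 x.1) (X (Sum.inl x)))
    (fun x => Polynomial.monomial (β x.1 x.2) (X (Sum.inr x))))
  let g : Fin m × Fin n → Polynomial (MvPolynomial (Fin m × Fin k ⊕ Fin k × Fin n) F) := fun x =>
    ∑ a, Polynomial.monomial (α a x.1 + β a x.2) (X (Sum.inl (x.1, a)) * X (Sum.inr (a, x.2)))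
  have hdeg : ∀ x, (g x).natDegree ≤ diagWeight m n b x := fun x =>
    Polynomial.natDegree_sum_le_of_forall_le _ _ fun a _ =>
      (Polynomial.natDegree_monomial_le _).trans (hle a x.1 x.2)
  have hcoeff : ∀ x ∈ u.support, (g x).coeff (diagWeight m n b x) ≠ 0 := by
    intro x hx h
    let ε : MvPolynomial (Fin m × Fin k ⊕ Fin k × Fin n) F →ₐ[F] F :=
      aeval (Sum.elim (fun y => if y.2 = (⟨lab x, hlab x hx⟩ : Fin k) then 1 else 0) fun _ => 1)
    have h1 := congrArg ε h
    have h2 : α ⟨lab x, hlab x hx⟩ x.1 + β ⟨lab x, hlab x hx⟩ x.2 = diagWeight m n b x :=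
      heq _ _ (Finset.mem_filter.2 ⟨hx, rfl⟩)
    refine one_ne_zero (α := F) ?_
    rw [map_zero] at h1
    rw [← h1]
    simp only [g, Polynomial.finsetSum_coeff, Polynomial.coeff_monomial, map_sum]
    rw [Finset.sum_eq_single ⟨lab x, hlab x hx⟩]
    · rw [if_pos h2]
      simp [ε]
    · intro a _ ha
      split_ifs
      · simp [ε, ha]
      · simp
    · simp
  have hG : ∀ f, Ψ (genProd F m n k f) = aeval g f := by
    intro f
    have : Ψ.comp (genProd F m n k) = aeval g := by
      refine MvPolynomial.algHom_ext fun x => ?_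
      simp only [Ψ, genProd, g, AlgHom.comp_apply, aeval_X, map_sum, map_mul, Sum.elim_inl,
        Sum.elim_inr, Polynomial.monomial_mul_monomial]
    exact DFunLike.congr_fun this f
  have hprodDeg : ∀ v : Fin m × Fin n →₀ ℕ,
      (∏ x, g x ^ v x).natDegree ≤ Finsupp.weight (diagWeight m n b) v := by
    intro v
    rw [Finsupp.weight_apply, Finsupp.sum_fintype _ _ (by simp)]
    exact (Polynomial.natDegree_prod_le _ _).trans (Finset.sum_le_sum fun x _ =>
      Polynomial.natDegree_pow_le_of_le _ (hdeg x))
  have hprodCoeff : (∏ x, g x ^ u x).coeff (Finsupp.weight (diagWeight m n b) u) ≠ 0 := by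
    rw [Finsupp.weight_apply, Finsupp.sum_fintype _ _ (by simp)]
    simp only [smul_eq_mul]
    rw [Polynomial.coeff_prod_sum_of_natDegree_le _ _ _ fun x _ =>
      Polynomial.natDegree_pow_le_of_le _ (hdeg x), Finset.prod_ne_zero_iff]
    intro x _
    rw [Polynomial.coeff_pow_of_natDegree_le (hdeg x)]
    by_cases hx : x ∈ u.support
    · exact pow_ne_zero _ (hcoeff x hx)
    · rw [Finsupp.notMem_support_iff.1 hx, pow_zero]
      exact one_ne_zero
  have h0 := congrArg (fun P => Polynomial.coeff P (Finsupp.weight (diagWeight m n b) u)) (hG f)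
  simp only [hf, map_zero, aeval_def, eval₂_eq', Polynomial.finsetSum_coeff,
    Polynomial.coeff_zero, ← Algebra.smul_def, Polynomial.coeff_smul] at h0
  rw [Finset.sum_eq_single u] at h0
  · exact smul_ne_zero (mem_support_iff.1 hu) hprodCoeff h0.symm
  · intro v hv hvu
    rw [Polynomial.coeff_eq_zero_of_natDegree_lt ((hprodDeg v).trans_lt (hlt v hv hvu)), smul_zero]
  · exact fun h => absurd hu h

/-- The second fundamental theorem: a polynomial vanishing on the matrices of rank at most `k` lies
in the ideal of minors of size `k + 1`. -/
theorem minorsIdeal_eq_ker_genProd (F : Type*) [Field F] (m n k : ℕ) :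
    minorsIdeal F m n (k + 1) = RingHom.ker (genProd F m n k) := by
  classical
  refine le_antisymm (minorsIdeal_le_ker_genProd F m n k) fun f hf => ?_
  set b := f.totalDegree + 2 with hb
  set w : (Fin m × Fin n →₀ ℕ) →+ ℕ := Finsupp.weight (diagWeight m n b) with hw
  have key : ∀ N : ℕ, ∀ g ∈ restrictSupport F {v | v.degree ≤ f.totalDegree ∧ w v < N},
      genProd F m n k g = 0 → g ∈ minorsIdeal F m n (k + 1) := by
    intro N
    induction N with
    | zero =>
      intro g hg _
      have : g = 0 := by
        rw [← support_eq_empty, ← Finset.coe_eq_empty, ← Set.subset_empty_iff]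
        exact fun v hv => Nat.not_lt_zero _ ((mem_restrictSupport_iff F).1 hg hv).2
      rw [this]
      exact Ideal.zero_mem _
    | succ N ih =>
      intro g hg hg0
      rw [mem_restrictSupport_iff] at hg
      by_cases hN : ∃ u ∈ g.support, w u = N
      · obtain ⟨u, hu, huN⟩ := hN
        have hlt : ∀ v ∈ g.support, v ≠ u → w v < w u := by
          intro v hv hvu
          have hexp : ∀ v ∈ g.support, ∀ x, v x < b := fun v hv x => by
            have := (Finsupp.le_degree x v).trans (hg hv).1
            omega
          refine lt_of_le_of_ne ?_ fun h =>
            hvu (eq_of_weight_diagWeight_eq (hexp v hv) (hexp u hu) h)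
          have := (hg hv).2
          omega
        obtain ⟨row, col, hrow, hcol, hdiag⟩ :=
          exists_diagonal_of_genProd_eq_zero (by omega) hg0 hu hlt
        let d : Equiv.Perm (Fin (k + 1)) → (Fin m × Fin n →₀ ℕ) := fun σ =>
          ∑ a, Finsupp.single (row (σ a), col a) 1
        have hdu : d 1 ≤ u := by
          intro x
          simp only [d, Finsupp.finsetSum_apply, Finsupp.single_apply, Equiv.Perm.one_apply]
          by_cases hx : ∃ a, (row a, col a) = x
          · obtain ⟨a, rfl⟩ := hx
            rw [Finset.sum_eq_single a, if_pos rfl]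
            · exact Nat.one_le_iff_ne_zero.2 (Finsupp.mem_support_iff.1 (hdiag a))
            · exact fun c _ hc => if_neg fun h => hc (hrow.injective (Prod.ext_iff.1 h).1)
            · simp
          · rw [Finset.sum_eq_zero fun a _ => if_neg fun h => hx ⟨a, h⟩]
            exact Nat.zero_le _
        have hwd : ∀ σ, w (d σ) = ∑ a, diagWeight m n b (row (σ a), col a) := fun σ => by
          simp [d, hw, Finsupp.weight_single]
        have hdd : ∀ σ, (d σ).degree = k + 1 := fun σ => by
          simp [d, map_sum]
        set δ := ((genMat F m n).submatrix row col).det with hδ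
        have hδJ : δ ∈ minorsIdeal F m n (k + 1) := Ideal.subset_span ⟨row, col, hrow, hcol, rfl⟩
        have hδd : δ = ∑ σ : Equiv.Perm (Fin (k + 1)),
            monomial (d σ) (((Equiv.Perm.sign σ : ℤˣ) : ℤ) : F) := by
          rw [hδ, Matrix.det_apply']
          refine Finset.sum_congr rfl fun σ _ => ?_
          simp only [d, monomial_sum_index, genMat, Matrix.submatrix_apply, Matrix.of_apply]
          simp [X]
        have hsub : monomial (u - d 1) (coeff u g) * δ ∈ minorsIdeal F m n (k + 1) :=
          Ideal.mul_mem_left _ _ hδJ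
        have hsplit : g - monomial (u - d 1) (coeff u g) * δ =
            (g - monomial u (coeff u g)) - ∑ σ ∈ Finset.univ.erase 1,
              monomial (u - d 1 + d σ) (coeff u g * (((Equiv.Perm.sign σ : ℤˣ) : ℤ) : F)) := by
          rw [hδd, ← Finset.add_sum_erase _ _ (Finset.mem_univ 1), mul_add, Finset.mul_sum,
            monomial_mul, tsub_add_cancel_of_le hdu, sub_sub]
          simp [monomial_mul]
        rw [← sub_add_cancel g (monomial (u - d 1) (coeff u g) * δ)]
        refine Ideal.add_mem _ (ih _ ?_ ?_) hsub
        · rw [hsplit]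
          refine Submodule.sub_mem _ ?_ (Submodule.sum_mem _ fun σ hσ => ?_)
          · rw [mem_restrictSupport_iff]
            intro v hv
            rw [Finset.mem_coe, mem_support_iff, coeff_sub, coeff_monomial] at hv
            by_cases huv : u = v
            · simp [huv] at hv
            · rw [if_neg huv, sub_zero, ← mem_support_iff] at hv
              exact ⟨(hg hv).1, huN ▸ hlt v hv (Ne.symm huv)⟩
          · rw [monomial_mem_restrictSupport]
            left
            have hdeg : (u - d 1).degree + (d 1).degree = u.degree := by
              rw [← map_add, tsub_add_cancel_of_le hdu]
            have hweight : w (u - d 1) + w (d 1) = N := by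
              rw [← map_add, tsub_add_cancel_of_le hdu, huN]
            have hperm := sum_diagWeight_perm_lt (b := b) (by omega) hrow hcol
              (Finset.ne_of_mem_erase hσ)
            have hone := hwd 1
            simp only [Equiv.Perm.one_apply] at hone
            rw [← hwd, ← hone] at hperm
            have := (hg hu).1
            rw [hdd] at hdeg
            refine ⟨?_, ?_⟩
            · rw [map_add, hdd]
              omega
            · rw [map_add]
              omega
        · rw [map_sub, hg0, (RingHom.mem_ker).1 (minorsIdeal_le_ker_genProd F m n k hsub), sub_zero]
      · refine ih g ((mem_restrictSupport_iff F).2 fun v hv => ⟨(hg hv).1, ?_⟩) hg0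
        exact lt_of_le_of_ne (Nat.lt_succ_iff.1 (hg hv).2) fun h => hN ⟨v, hv, h⟩
  refine key (f.support.sup w + 1) f ((mem_restrictSupport_iff F).2 fun v hv => ⟨?_, ?_⟩) hf
  · exact le_totalDegree hv
  · exact Nat.lt_succ_iff.2 (Finset.le_sup (f := w) hv)

/-! ### The containment -/

theorem pow_minorsIdeal_zmod_le_bracketPow {p : ℕ} [Fact p.Prime] {m n t k L : ℕ} (e : ℕ)
    (hkm : k ≤ m) (hkn : k ≤ n) (hL : p ^ e * ((m - k) * (n - k)) < (t - k) * L) :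
    minorsIdeal (ZMod p) m n t ^ L ≤ bracketPow (minorsIdeal (ZMod p) m n (k + 1)) (p ^ e) := by
  intro f hf
  obtain ⟨M, hM⟩ := exists_leadingMinor_pow_mul_mem_bracketPow (ZMod p) hkm hkn hL hf
  refine MvPolynomial.mem_bracketPow_of_pow_mul_mem e _ (leadingMinor (ZMod p) hkm hkn ^ M) f ?_ ?_
  · intro g hg
    rw [minorsIdeal_eq_ker_genProd, RingHom.mem_ker, map_mul, map_pow] at hg
    rw [minorsIdeal_eq_ker_genProd, RingHom.mem_ker]
    exact (mul_eq_zero.1 hg).resolve_left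
      (pow_ne_zero _ (genProd_leadingMinor_ne_zero (ZMod p) hkm hkn))
  · have hMe : M ≤ M * p ^ e := Nat.le_mul_of_pos_right M (pow_pos (Fact.out : p.Prime).pos e)
    rw [← pow_mul, ← Nat.sub_add_cancel hMe, pow_add, mul_assoc]
    exact Ideal.mul_mem_left _ _ hM

theorem map_minorsIdeal {K F : Type*} [Field K] [Field F] (φ : K →+* F) (m n s : ℕ) :
    (minorsIdeal K m n s).map (MvPolynomial.map φ) = minorsIdeal F m n s := by
  have hdet : ∀ (row : Fin s → Fin m) (col : Fin s → Fin n),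
      MvPolynomial.map φ ((genMat K m n).submatrix row col).det =
        ((genMat F m n).submatrix row col).det := by
    intro row col
    rw [RingHom.map_det]
    congr 1
    ext i j : 2
    simp [genMat]
  rw [minorsIdeal, minorsIdeal, Ideal.map_span]
  congr 1
  ext f
  constructor
  · rintro ⟨_, ⟨row, col, hrow, hcol, rfl⟩, rfl⟩
    exact ⟨row, col, hrow, hcol, hdet row col⟩
  · rintro ⟨row, col, hrow, hcol, rfl⟩
    exact ⟨_, ⟨row, col, hrow, hcol, rfl⟩, hdet row col⟩

theorem map_bracketPow_le {R S : Type*} [CommRing R] [CommRing S] (φ : R →+* S) (J : Ideal R)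
    (q : ℕ) : (bracketPow J q).map φ ≤ bracketPow (J.map φ) q := by
  rw [bracketPow, Ideal.map_span, Ideal.span_le]
  rintro _ ⟨_, ⟨a, ha, rfl⟩, rfl⟩
  exact Ideal.subset_span ⟨φ a, Ideal.mem_map_of_mem φ ha, (map_pow φ a q).symm⟩

/-- For `0 ≤ k ≤ t-1` there is an `N ∈ ℕ` such that `I_t^{N+l} ⊆ I_{k+1}^{[q]}` whenever
`l ≥ 1`, `q = p^e`, and `(t-k)l > (q-1)(m-k)(n-k)`. -/
theorem pow_le_frobeniusPow (p : ℕ) (hp : p.Prime)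
    (𝔽 : Type*) [Field 𝔽] [CharP 𝔽 p]
    (m n t : ℕ) (ht : 0 < t) (htm : t ≤ m) (hmn : m ≤ n)
    (k : ℕ) (hk : k ≤ t - 1) :
    ∃ N : ℕ, ∀ l e : ℕ, 1 ≤ l → 1 ≤ e →
      (p ^ e - 1) * ((m - k) * (n - k)) < (t - k) * l →
      minorsIdeal 𝔽 m n t ^ (N + l) ≤ bracketPow (minorsIdeal 𝔽 m n (k + 1)) (p ^ e) := by
  have := Fact.mk hp
  refine ⟨(m - k) * (n - k), fun l e _ _ hl => ?_⟩
  have hL : p ^ e * ((m - k) * (n - k)) < (t - k) * ((m - k) * (n - k) + l) := by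
    obtain ⟨q, hq⟩ := Nat.exists_eq_add_of_le' (Nat.one_le_pow e p hp.pos)
    rw [hq, Nat.add_sub_cancel] at hl
    have htk : (m - k) * (n - k) ≤ (t - k) * ((m - k) * (n - k)) :=
      Nat.le_mul_of_pos_left _ (by omega)
    rw [hq, add_mul, mul_add, one_mul]
    omega
  have h := Ideal.map_mono (f := MvPolynomial.map (ZMod.castHom (dvd_refl p) 𝔽))
    (pow_minorsIdeal_zmod_le_bracketPow e (by omega) (by omega) hL)
  rw [Ideal.map_pow, map_minorsIdeal] at h
  refine h.trans ((map_bracketPow_le _ _ _).trans ?_)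
  rw [map_minorsIdeal]
end

section
/- Fix positive integers t ≤ m ≤ n, let X be an m×n matrix of indeterminates over a field 𝔽 of prime characteristic p, R = 𝔽[X], and I_t the ideal of t×t minors of X. Let k be the least integer in [0, t−1] with (m−k)(n−k)/(t−k) ≤ (m−k−1)(n−k−1)/(t−k−1) (division by zero interpreted as infinity), and let Δ be the element defined from Δ_k, Δ_k' and u = t(m+n−2k) − mn + k² as in the construction below. Then there exists a nonzero homogeneous polynomial f ∈ R such that f·Δ^l ∈ I_t^{(m−k)(n−k)l} for all integers l ≥ 1. -/
open MvPolynomial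

/-- The minor of the generic `m × n` matrix with the `s` consecutive rows
`r0+1, …, r0+s` and the `s` consecutive columns `c0+1, …, c0+s` (in `1`-based terms).
Indices are clamped into range; in all uses below they are within range, so this is
exactly the minor `[r0+1,…,r0+s | c0+1,…,c0+s]`. -/
noncomputable def intervalMinor (𝔽 : Type*) [Field 𝔽] (m n : ℕ) (s r0 c0 : ℕ) :
    MvPolynomial (Fin m × Fin n) 𝔽 :=
  if h : 0 < m ∧ 0 < n then
    (Matrix.of fun i j : Fin s =>
      (MvPolynomial.X (⟨min (r0 + (i : ℕ)) (m - 1), by omega⟩,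
        ⟨min (c0 + (j : ℕ)) (n - 1), by omega⟩) : MvPolynomial (Fin m × Fin n) 𝔽)).det
  else 0

/-- The element `Δ_k`, the product of the minors
`[1,…,m | i,…,i+m-1]` for `i = 1, …, n-m+1`, and
`[j,…,m | 1,…,m-j+1]·[1,…,m-j+1 | n-m+j,…,n]` for `j = 2, …, m-k`. -/
noncomputable def Delta (𝔽 : Type*) [Field 𝔽] (m n k : ℕ) :
    MvPolynomial (Fin m × Fin n) 𝔽 :=
  (∏ i ∈ Finset.range (n - m + 1), intervalMinor 𝔽 m n m 0 i) *
    ∏ j ∈ Finset.Icc 2 (m - k),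
      intervalMinor 𝔽 m n (m - j + 1) (j - 1) 0 *
        intervalMinor 𝔽 m n (m - j + 1) 0 (n - m + j - 1)

/-- The element `Δ_k' = Δ_k · [m-k+1,…,m | 1,…,k]` (for `k ≥ 1`). -/
noncomputable def Delta' (𝔽 : Type*) [Field 𝔽] (m n k : ℕ) :
    MvPolynomial (Fin m × Fin n) 𝔽 :=
  Delta 𝔽 m n k * intervalMinor 𝔽 m n k (m - k) 0

/-- The integer `u = t(m+n-2k) - mn + k²`. -/
def uInt (t m n k : ℕ) : ℤ :=
  (t : ℤ) * ((m : ℤ) + (n : ℤ) - 2 * (k : ℤ)) - (m : ℤ) * (n : ℤ) + (k : ℤ) ^ 2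

/-- The element `Δ`:  `Δ_0^t` if `k = 0`;  `Δ_k^u · (Δ_k')^{t-k-u}` if `k ≥ 1` and `u ≥ 0`;
and `(Δ_k')^{t-k+u} · Δ_{k-1}^{-u}` if `k ≥ 1` and `u < 0`. -/
noncomputable def DeltaMain (𝔽 : Type*) [Field 𝔽] (m n t k : ℕ) :
    MvPolynomial (Fin m × Fin n) 𝔽 :=
  if k = 0 then Delta 𝔽 m n 0 ^ t
  else if 0 ≤ uInt t m n k then
    Delta 𝔽 m n k ^ (uInt t m n k).toNat *
      Delta' 𝔽 m n k ^ ((t : ℤ) - (k : ℤ) - uInt t m n k).toNat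
  else
    Delta' 𝔽 m n k ^ ((t : ℤ) - (k : ℤ) + uInt t m n k).toNat *
      Delta 𝔽 m n (k - 1) ^ (-uInt t m n k).toNat

/-- The condition `(m-k)(n-k)/(t-k) ≤ (m-k-1)(n-k-1)/(t-k-1)`, where a positive integer
divided by zero is interpreted as infinity: for `k = t-1` the right-hand side is infinite
and the condition holds automatically. -/
def minCond (t m n k : ℕ) : Prop :=
  k = t - 1 ∨
    (((m - k) * (n - k) : ℕ) : ℝ) / ((t - k : ℕ) : ℝ) ≤
      (((m - k - 1) * (n - k - 1) : ℕ) : ℝ) / ((t - k - 1 : ℕ) : ℝ)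

section ValuativeCriterion

variable {R K : Type*} [CommRing R] [Field K] [Algebra R K]

/-- The subring of `K` of fractions `y / x ^ d` with `y ∈ L ^ d`, where `x ∈ L`. -/
def blowupChart (K : Type*) [Field K] [Algebra R K] (L : Ideal R) {x : R} (hx : x ∈ L) :
    Subring K where
  carrier := {a | ∃ d, ∃ y ∈ L ^ d, a * algebraMap R K x ^ d = algebraMap R K y}
  one_mem' := ⟨0, 1, by simp, by simp⟩
  zero_mem' := ⟨0, 0, by simp, by simp⟩
  mul_mem' := by
    rintro a b ⟨d, y, hy, h⟩ ⟨e, z, hz, h'⟩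
    refine ⟨d + e, y * z, pow_add L d e ▸ Ideal.mul_mem_mul hy hz, ?_⟩
    rw [map_mul, ← h, ← h']; ring
  neg_mem' := by
    rintro a ⟨d, y, hy, h⟩
    exact ⟨d, -y, neg_mem hy, by rw [map_neg, ← h]; ring⟩
  add_mem' := by
    rintro a b ⟨d, y, hy, h⟩ ⟨e, z, hz, h'⟩
    refine ⟨d + e, y * x ^ e + z * x ^ d, add_mem ?_ ?_, ?_⟩
    · exact pow_add L d e ▸ Ideal.mul_mem_mul hy (Ideal.pow_mem_pow hx e)
    · exact add_comm e d ▸ pow_add L e d ▸ Ideal.mul_mem_mul hz (Ideal.pow_mem_pow hx d)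
    · simp only [map_add, map_mul, map_pow, ← h, ← h']; ring

/-- The ideal of the chart `blowupChart K L hx` consisting of the fractions `y / x ^ (d + 1)`
with `y ∈ J * L ^ d`. -/
def blowupChartIdeal (K : Type*) [Field K] [Algebra R K] (J L : Ideal R) {x : R} (hx : x ∈ L) :
    Ideal (blowupChart K L hx) where
  carrier := {a | ∃ d, ∃ y ∈ J * L ^ d,
    (a : K) * algebraMap R K x ^ (d + 1) = algebraMap R K y}
  zero_mem' := ⟨0, 0, by simp, by simp⟩
  add_mem' := by
    rintro a b ⟨d, y, hy, h⟩ ⟨e, z, hz, h'⟩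
    have key : ∀ d e : ℕ, ∀ y ∈ J * L ^ d, y * x ^ (e + 1) ∈ J * L ^ (d + e + 1) := by
      intro d e y hy
      rw [add_assoc, pow_add, ← mul_assoc]
      exact Ideal.mul_mem_mul hy (Ideal.pow_mem_pow hx _)
    refine ⟨d + e + 1, y * x ^ (e + 1) + z * x ^ (d + 1),
      add_mem (key d e y hy) (add_comm e d ▸ key e d z hz), ?_⟩
    simp only [map_add, map_mul, map_pow, ← h, ← h', Subring.coe_add]; ring
  smul_mem' := by
    rintro ⟨b, e, z, hz, h'⟩ a ⟨d, y, hy, h⟩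
    refine ⟨d + e, y * z, ?_, ?_⟩
    · rw [pow_add, ← mul_assoc]
      exact Ideal.mul_mem_mul hy hz
    · simp only [map_mul, ← h, ← h', smul_eq_mul, Subring.coe_mul]; ring

theorem Ideal.sup_span_singleton_pow_succ_le (J : Ideal R) (x : R) (d : ℕ) :
    (J ⊔ Ideal.span {x}) ^ (d + 1) ≤
      J * (J ⊔ Ideal.span {x}) ^ d ⊔ Ideal.span {x ^ (d + 1)} := by
  induction d with
  | zero => simp
  | succ d ih =>
    set L := J ⊔ Ideal.span {x}
    have hx : Ideal.span {x} ≤ L := le_sup_right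
    calc L ^ (d + 1 + 1) = L ^ (d + 1) * L := pow_succ _ _
      _ ≤ (J * L ^ d ⊔ Ideal.span {x ^ (d + 1)}) * L := Ideal.mul_mono_left ih
      _ = J * L ^ (d + 1) ⊔ Ideal.span {x ^ (d + 1)} * (J ⊔ Ideal.span {x}) := by
        rw [Ideal.sup_mul, mul_assoc, ← pow_succ]
      _ ≤ _ := by
        rw [Ideal.mul_sup, Ideal.span_singleton_mul_span_singleton, ← pow_succ]
        refine sup_le le_sup_left (sup_le (le_trans ?_ le_sup_left) le_sup_right)
        rw [mul_comm]
        refine Ideal.mul_mono_right ?_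
        rw [← Ideal.span_singleton_pow]
        exact Ideal.pow_right_mono hx _

/-- A form of the valuative criterion for integral closure of ideals: if `x` lies in the extension
of `J` to every valuation ring of the fraction field, then some fixed power of `x` multiplies
each `x ^ l` into `J ^ l`. -/
theorem exists_pow_mul_pow_mem_pow [FaithfulSMul R K] {J : Ideal R} {x : R}
    (hx0 : x ≠ 0) (h : ∀ (V : ValuationSubring K) (φ : R →+* V), φ x ∈ J.map φ) :
    ∃ d : ℕ, ∀ l : ℕ, x ^ d * x ^ l ∈ J ^ l := by
  set L := J ⊔ Ideal.span {x}
  have hxL : x ∈ L := Ideal.mem_sup_right (Ideal.mem_span_singleton_self x)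
  have hinj : Function.Injective (algebraMap R K) := FaithfulSMul.algebraMap_injective R K
  have hxK : algebraMap R K x ≠ 0 := by
    rwa [Ne, map_eq_zero_iff _ hinj]
  have htop : blowupChartIdeal K J L hxL = ⊤ := by
    by_contra hne
    obtain ⟨V, hAV, hV⟩ := Ideal.image_subset_nonunits_valuationSubring _ hne
    have hR : ∀ r : R, algebraMap R K r ∈ V.toSubring := fun r =>
      hAV ⟨0, r, by simp, by simp⟩
    let φ : R →+* V := (algebraMap R K).codRestrict V.toSubring hR
    have hmax : ∀ y ∈ J.map φ, ∃ z ∈ IsLocalRing.maximalIdeal V, y = z * φ x := by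
      intro y hy
      induction hy using Submodule.span_induction with
      | mem y hy =>
        obtain ⟨j, hj, rfl⟩ := hy
        have hjJ : (algebraMap R K j / algebraMap R K x) * algebraMap R K x ^ (0 + 1)
            = algebraMap R K j := by rw [zero_add, pow_one, div_mul_cancel₀ _ hxK]
        have hmem : algebraMap R K j / algebraMap R K x ∈ blowupChart K L hxL :=
          ⟨1, j, by simpa using Ideal.mem_sup_left hj, hjJ⟩
        have := hV ⟨⟨_, hmem⟩, ⟨0, j, by simpa using hj, hjJ⟩, rfl⟩
        rw [← V.image_maximalIdeal] at this
        obtain ⟨z, hz, hz'⟩ := this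
        refine ⟨z, hz, Subtype.ext ?_⟩
        have hz' : (z : K) = algebraMap R K j / algebraMap R K x := hz'
        change algebraMap R K j = z * algebraMap R K x
        rw [hz']; field_simp
      | zero => exact ⟨0, zero_mem _, by simp⟩
      | add a b _ _ ha hb =>
        obtain ⟨z, hz, rfl⟩ := ha
        obtain ⟨w, hw, rfl⟩ := hb
        exact ⟨z + w, add_mem hz hw, by ring⟩
      | smul c a _ ha =>
        obtain ⟨z, hz, rfl⟩ := ha
        exact ⟨c * z, Ideal.mul_mem_left _ c hz, by simp [mul_assoc]⟩
    obtain ⟨z, hz, hzx⟩ := hmax _ (h V φ)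
    have hφx : φ x ≠ 0 := fun h0 => hxK (congrArg Subtype.val h0)
    have hz1 : z = 1 := mul_right_cancel₀ hφx (by rw [← hzx, one_mul])
    exact (Ideal.ne_top_iff_one _).1 (IsLocalRing.maximalIdeal.isMaximal V).ne_top (hz1 ▸ hz)
  obtain ⟨d, y, hy, hxy⟩ := (Ideal.eq_top_iff_one _).1 htop
  rw [OneMemClass.coe_one, one_mul, ← map_pow] at hxy
  have hxd : x ^ (d + 1) ∈ J * L ^ d := hinj hxy ▸ hy
  have hstep : L ^ (d + 1) ≤ J * L ^ d :=
    (Ideal.sup_span_singleton_pow_succ_le J x d).trans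
      (sup_le le_rfl ((Ideal.span_singleton_le_iff_mem _).2 hxd))
  have hpow : ∀ l : ℕ, L ^ (d + l) ≤ J ^ l * L ^ d := by
    intro l
    induction l with
    | zero => simp
    | succ l ih =>
      calc L ^ (d + (l + 1)) = L ^ (d + l) * L := by rw [← add_assoc, pow_succ]
        _ ≤ J ^ l * L ^ d * L := Ideal.mul_mono_left ih
        _ = J ^ l * L ^ (d + 1) := by rw [mul_assoc, ← pow_succ]
        _ ≤ J ^ l * (J * L ^ d) := Ideal.mul_mono_right hstep
        _ = J ^ (l + 1) * L ^ d := by rw [← mul_assoc, ← pow_succ]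
  refine ⟨d, fun l => ?_⟩
  rw [← pow_add]
  exact Ideal.mul_le_left (hpow l (Ideal.pow_mem_pow hxL _))

end ValuativeCriterion

section DetIdeal

variable {V ι κ ι' κ' : Type*} [CommRing V]

/-- The ideal generated by the determinants of all `r × r` matrices whose rows and columns are
rows and columns of `M`, in any order and possibly repeated. -/
def Matrix.detIdeal (r : ℕ) (M : Matrix ι κ V) : Ideal V :=
  Ideal.span {a | ∃ (f : Fin r → ι) (g : Fin r → κ), a = (M.submatrix f g).det}

theorem Matrix.det_mem_detIdeal {r : ℕ} (M : Matrix ι κ V) (f : Fin r → ι) (g : Fin r → κ) :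
    (M.submatrix f g).det ∈ M.detIdeal r :=
  Ideal.subset_span ⟨f, g, rfl⟩

theorem Matrix.detIdeal_transpose (r : ℕ) (M : Matrix ι κ V) :
    M.transpose.detIdeal r = M.detIdeal r := by
  apply le_antisymm <;> refine Ideal.span_le.2 ?_
  · rintro _ ⟨f, g, rfl⟩
    rw [← Matrix.det_transpose]
    exact det_mem_detIdeal M g f
  · rintro _ ⟨f, g, rfl⟩
    rw [← Matrix.det_transpose]
    exact det_mem_detIdeal M.transpose g f

theorem Matrix.detIdeal_mul_left [Fintype ι] (r : ℕ) (A : Matrix ι' ι V) (M : Matrix ι κ V) :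
    (A * M).detIdeal r ≤ M.detIdeal r := by
  refine Ideal.span_le.2 ?_
  rintro _ ⟨f, g, rfl⟩
  have hrow : (A * M).submatrix f g = fun i => ∑ k, A (f i) k • (fun j => M k (g j)) := by
    ext i j
    simp [Matrix.mul_apply]
  have hdet : ((A * M).submatrix f g).det =
      ∑ φ : Fin r → ι, (∏ i, A (f i) (φ i)) • (M.submatrix φ g).det := by
    classical
    rw [hrow]
    change Matrix.detRowAlternating.toMultilinearMap _ = _
    rw [MultilinearMap.map_sum]
    exact Finset.sum_congr rfl fun φ _ => MultilinearMap.map_smul_univ _ _ _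
  rw [hdet]
  exact Ideal.sum_mem _ fun φ _ => Ideal.mul_mem_left _ _ (det_mem_detIdeal M φ g)

theorem Matrix.detIdeal_mul_right [Fintype κ] (r : ℕ) (M : Matrix ι κ V) (B : Matrix κ κ' V) :
    (M * B).detIdeal r ≤ M.detIdeal r := by
  rw [← detIdeal_transpose, ← detIdeal_transpose r M, Matrix.transpose_mul]
  exact detIdeal_mul_left _ _ _

/-- Two matrices are mutual factors if each is obtained from the other by multiplying with
matrices on the left and on the right. -/
def Matrix.MutualFactors [Fintype ι] [Fintype κ] (M N : Matrix ι κ V) : Prop :=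
  (∃ (A : Matrix ι ι V) (B : Matrix κ κ V), M = A * N * B) ∧
    ∃ (P : Matrix ι ι V) (Q : Matrix κ κ V), N = P * M * Q

namespace Matrix.MutualFactors

variable [Fintype ι] [Fintype κ] {M N N' : Matrix ι κ V}

theorem trans (h : M.MutualFactors N) (h' : N.MutualFactors N') : M.MutualFactors N' := by
  obtain ⟨⟨A, B, hA⟩, P, Q, hP⟩ := h
  obtain ⟨⟨A', B', hA'⟩, P', Q', hP'⟩ := h'
  refine ⟨⟨A * A', B' * B, ?_⟩, P' * P, Q * Q', ?_⟩
  · rw [hA, hA']; simp only [Matrix.mul_assoc]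
  · rw [hP', hP]; simp only [Matrix.mul_assoc]

theorem smul (a : V) (h : M.MutualFactors N) : (a • M).MutualFactors (a • N) := by
  obtain ⟨⟨A, B, hA⟩, P, Q, hP⟩ := h
  exact ⟨⟨A, B, by rw [hA]; simp⟩, P, Q, by rw [hP]; simp⟩

theorem submatrix_equiv [DecidableEq ι] [DecidableEq κ] (M : Matrix ι κ V) (e : ι ≃ ι)
    (f : κ ≃ κ) : M.MutualFactors (M.submatrix e f) := by
  have key : ∀ (M : Matrix ι κ V) (e : ι ≃ ι) (f : κ ≃ κ),
      M.submatrix e f = (1 : Matrix ι ι V).submatrix e id * M *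
        (1 : Matrix κ κ V).submatrix id f := by
    intro M e f
    ext i j
    simp [Matrix.mul_apply, Matrix.one_apply]
  exact ⟨⟨_, _, (by simp : M = (M.submatrix e f).submatrix e.symm f.symm).trans (key _ _ _)⟩,
    _, _, key M e f⟩

theorem detIdeal_eq (h : M.MutualFactors N) (r : ℕ) : M.detIdeal r = N.detIdeal r := by
  obtain ⟨⟨A, B, hA⟩, P, Q, hP⟩ := h
  apply le_antisymm
  · rw [hA]
    exact (detIdeal_mul_right _ _ _).trans (detIdeal_mul_left _ _ _)
  · rw [hP]
    exact (detIdeal_mul_right _ _ _).trans (detIdeal_mul_left _ _ _)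

end Matrix.MutualFactors

/-- The block diagonal matrix with blocks `1` and `N`. -/
def Matrix.oneBlock {m n : ℕ} (N : Matrix (Fin m) (Fin n) V) :
    Matrix (Fin (m + 1)) (Fin (n + 1)) V :=
  Fin.cons (Fin.cons 1 0) fun i => Fin.cons 0 (N i)

section oneBlock

variable {m n l : ℕ} (N : Matrix (Fin m) (Fin n) V)

@[simp] theorem Matrix.oneBlock_zero_zero : N.oneBlock 0 0 = 1 := rfl
@[simp] theorem Matrix.oneBlock_zero_succ (j : Fin n) : N.oneBlock 0 j.succ = 0 := rfl
@[simp] theorem Matrix.oneBlock_succ_zero (i : Fin m) : N.oneBlock i.succ 0 = 0 := rfl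
@[simp] theorem Matrix.oneBlock_succ_succ (i : Fin m) (j : Fin n) :
    N.oneBlock i.succ j.succ = N i j := rfl

theorem Matrix.oneBlock_mul (N' : Matrix (Fin n) (Fin l) V) :
    (N * N').oneBlock = N.oneBlock * N'.oneBlock := by
  ext i j
  cases i using Fin.cases <;> cases j using Fin.cases <;>
    simp [Matrix.mul_apply, Fin.sum_univ_succ]

theorem Matrix.MutualFactors.oneBlock {N N' : Matrix (Fin m) (Fin n) V}
    (h : N.MutualFactors N') : N.oneBlock.MutualFactors N'.oneBlock := by
  obtain ⟨⟨A, B, hA⟩, P, Q, hP⟩ := h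
  exact ⟨⟨A.oneBlock, B.oneBlock, by rw [hA]; simp only [oneBlock_mul]⟩,
    P.oneBlock, Q.oneBlock, by rw [hP]; simp only [oneBlock_mul]⟩

/-- Clearing the first row and column with a pivot equal to `1`. -/
theorem Matrix.mutualFactors_oneBlock (M : Matrix (Fin (m + 1)) (Fin (n + 1)) V)
    (h : M 0 0 = 1) :
    M.MutualFactors
      (Matrix.of fun i j => M i.succ j.succ - M i.succ 0 * M 0 j.succ).oneBlock := by
  let col (c : V) : Matrix (Fin (m + 1)) (Fin (m + 1)) V :=
    Fin.cons (Fin.cons 1 0) fun i => Fin.cons (c * M i.succ 0) ((1 : Matrix _ _ V) i)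
  let row (c : V) : Matrix (Fin (n + 1)) (Fin (n + 1)) V :=
    Fin.cons (Fin.cons 1 fun j => c * M 0 j.succ) fun i => Fin.cons 0 ((1 : Matrix _ _ V) i)
  have c00 (c) : col c 0 0 = 1 := rfl
  have c01 (c) (j : Fin m) : col c 0 j.succ = 0 := rfl
  have c10 (c) (i : Fin m) : col c i.succ 0 = c * M i.succ 0 := rfl
  have c11 (c) (i j : Fin m) : col c i.succ j.succ = (1 : Matrix _ _ V) i j := rfl
  have r00 (c) : row c 0 0 = 1 := rfl
  have r01 (c) (j : Fin n) : row c 0 j.succ = c * M 0 j.succ := rfl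
  have r10 (c) (i : Fin n) : row c i.succ 0 = 0 := rfl
  have r11 (c) (i j : Fin n) : row c i.succ j.succ = (1 : Matrix _ _ V) i j := rfl
  refine ⟨⟨col 1, row 1, ?_⟩, col (-1), row (-1), ?_⟩ <;> ext i j <;>
    cases i using Fin.cases <;> cases j using Fin.cases <;>
    (simp [Matrix.mul_apply, Fin.sum_univ_succ, c00, c01, c10, c11, r00, r01, r10, r11,
      Matrix.one_apply, h]; try ring)

end oneBlock

/-- The rectangular diagonal matrix whose diagonal entries are the partial products of `q`. -/
def Matrix.partialProdDiag (m n : ℕ) (q : ℕ → V) : Matrix (Fin m) (Fin n) V :=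
  Matrix.of fun i j => if (i : ℕ) = j then ∏ a ∈ Finset.range (i + 1), q a else 0

theorem Matrix.smul_oneBlock_partialProdDiag (m n : ℕ) (q : ℕ → V) (a : V) :
    a • (partialProdDiag m n q).oneBlock =
      partialProdDiag (m + 1) (n + 1) (fun i => Nat.casesOn i a q) := by
  ext i j
  cases i using Fin.cases <;> cases j using Fin.cases <;>
    simp [partialProdDiag, Finset.prod_range_succ', mul_comm]

theorem Finset.prod_range_card_dvd_prod {d : ℕ → V} (hd : ∀ i j, i ≤ j → d i ∣ d j)
    (s : Finset ℕ) : ∏ i ∈ Finset.range s.card, d i ∣ ∏ i ∈ s, d i := by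
  induction s using Finset.induction_on_max with
  | empty => simp
  | insert a s ha ih =>
    have has : a ∉ s := fun h => (ha a h).false
    rw [Finset.card_insert_of_notMem has, Finset.prod_range_succ, Finset.prod_insert has,
      mul_comm (d a)]
    refine mul_dvd_mul ih (hd _ _ ?_)
    have : s ⊆ Finset.range a := fun x hx => Finset.mem_range.2 (ha x hx)
    simpa using Finset.card_le_card this

theorem Finset.prod_range_prod_range_succ (q : ℕ → V) (r m : ℕ) (hrm : r ≤ m) :
    ∏ i ∈ Finset.range r, ∏ a ∈ Finset.range (i + 1), q a =
      ∏ a ∈ Finset.range m, q a ^ (r - a) := by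
  induction r with
  | zero => simp
  | succ r ih =>
    have hprod : ∏ a ∈ Finset.range (r + 1), q a =
        ∏ a ∈ Finset.range m, if a < r + 1 then q a else 1 := by
      rw [← Finset.prod_filter]
      congr 1
      ext a
      simp only [Finset.mem_range, Finset.mem_filter]
      omega
    rw [Finset.prod_range_succ, ih (by omega), hprod, ← Finset.prod_mul_distrib]
    refine Finset.prod_congr rfl fun a _ => ?_
    split_ifs with h
    · rw [← pow_succ]; congr 1; omega
    · rw [mul_one]; congr 1; omega

theorem Matrix.detIdeal_partialProdDiag_le {m n : ℕ} (q : ℕ → V) (r : ℕ) :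
    (partialProdDiag m n q).detIdeal r ≤
      Ideal.span {∏ i ∈ Finset.range r, ∏ a ∈ Finset.range (i + 1), q a} := by
  set d : ℕ → V := fun i => ∏ a ∈ Finset.range (i + 1), q a with hd
  have hdvd : ∀ i j, i ≤ j → d i ∣ d j := fun i j hij =>
    Finset.prod_dvd_prod_of_subset _ _ _ (Finset.range_mono (by omega))
  refine Ideal.span_le.2 ?_
  rintro _ ⟨f, g, rfl⟩
  refine Ideal.mem_span_singleton.2 ?_
  by_cases hf : Function.Injective f
  · have hmat : (partialProdDiag m n q).submatrix f g =
        Matrix.diagonal (fun i => d (f i)) *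
          Matrix.of fun i j => if (f i : ℕ) = g j then (1 : V) else 0 := by
      ext i j
      simp [partialProdDiag, Matrix.diagonal_mul, hd]
    rw [hmat, Matrix.det_mul, Matrix.det_diagonal]
    refine Dvd.dvd.mul_right ?_ _
    have hinj : Function.Injective fun i => (f i : ℕ) := Fin.val_injective.comp hf
    have := Finset.prod_range_card_dvd_prod hdvd (Finset.univ.map ⟨_, hinj⟩)
    simpa using this
  · obtain ⟨i, j, hij, hne⟩ : ∃ i j, f i = f j ∧ i ≠ j := by
      simpa [Function.Injective] using hf
    rw [Matrix.det_zero_of_row_eq hne (by ext; simp [hij])]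
    exact dvd_zero _

theorem Matrix.prod_mem_detIdeal_partialProdDiag {m n r : ℕ} (q : ℕ → V) (hm : r ≤ m)
    (hn : r ≤ n) :
    ∏ i ∈ Finset.range r, ∏ a ∈ Finset.range (i + 1), q a ∈
      (partialProdDiag m n q).detIdeal r := by
  have hmat : (partialProdDiag m n q).submatrix (Fin.castLE hm) (Fin.castLE hn) =
      Matrix.diagonal fun i : Fin r => ∏ a ∈ Finset.range ((i : ℕ) + 1), q a := by
    ext i j
    simp [partialProdDiag, Matrix.diagonal_apply, Fin.ext_iff]
  have := det_mem_detIdeal (partialProdDiag m n q) (Fin.castLE hm) (Fin.castLE hn)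
  rw [hmat, Matrix.det_diagonal] at this
  rwa [← Fin.prod_univ_eq_prod_range]

variable [IsDomain V] [ValuationRing V]

theorem ValuationRing.exists_dvd_of_finite {α : Type*} [Finite α] [Nonempty α] (f : α → V) :
    ∃ a, ∀ b, f a ∣ f b := by
  classical
  have := Fintype.ofFinite α
  have : ∀ s : Finset α, s.Nonempty → ∃ a ∈ s, ∀ b ∈ s, f a ∣ f b := by
    intro s hs
    induction hs using Finset.Nonempty.cons_induction with
    | singleton a => exact ⟨a, by simp, by simp⟩
    | cons a s ha hs ih =>
      obtain ⟨c, hc, hcs⟩ := ih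
      rcases ValuationRing.dvd_total (f a) (f c) with h | h
      · refine ⟨a, by simp, fun b hb => ?_⟩
        rcases Finset.mem_cons.1 hb with rfl | hb
        · exact dvd_rfl
        · exact h.trans (hcs b hb)
      · refine ⟨c, by simp [hc], fun b hb => ?_⟩
        rcases Finset.mem_cons.1 hb with rfl | hb
        · exact h
        · exact hcs b hb
  obtain ⟨a, -, ha⟩ := this Finset.univ Finset.univ_nonempty
  exact ⟨a, fun b => ha b (Finset.mem_univ b)⟩

/-- Every nonempty matrix over a valuation ring is a multiple of a matrix having an entry `1`. -/
theorem Matrix.exists_eq_smul_of_valuationRing [Finite ι] [Finite κ] [Nonempty ι] [Nonempty κ]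
    (M : Matrix ι κ V) :
    ∃ (a : V) (M' : Matrix ι κ V) (i : ι) (j : κ), M' i j = 1 ∧ M = a • M' := by
  classical
  obtain ⟨⟨i, j⟩, hij⟩ := ValuationRing.exists_dvd_of_finite fun x : ι × κ => M x.1 x.2
  choose c hc using fun x : ι × κ => hij x
  refine ⟨M i j, Matrix.of fun i' j' => if i' = i ∧ j' = j then 1 else c (i', j'), i, j, by simp, ?_⟩
  ext i' j'
  by_cases h : i' = i ∧ j' = j
  · simp [h]
  · simpa [h] using hc (i', j')

/-- Smith normal form over a valuation ring. -/
theorem Matrix.exists_mutualFactors_partialProdDiag (m n : ℕ) (M : Matrix (Fin m) (Fin n) V) :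
    ∃ q : ℕ → V, M.MutualFactors (partialProdDiag m n q) := by
  induction m generalizing n with
  | zero => exact ⟨1, ⟨1, 1, by ext i; exact i.elim0⟩, 1, 1, by ext i; exact i.elim0⟩
  | succ m ih =>
    cases n with
    | zero => exact ⟨1, ⟨1, 1, by ext i j; exact j.elim0⟩, 1, 1, by ext i j; exact j.elim0⟩
    | succ n =>
      obtain ⟨a, M', i, j, hij, rfl⟩ := M.exists_eq_smul_of_valuationRing
      obtain ⟨q, hq⟩ := ih n _
      refine ⟨fun i => Nat.casesOn i a q, ?_⟩
      rw [← smul_oneBlock_partialProdDiag]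
      refine MutualFactors.smul a ?_
      refine (MutualFactors.submatrix_equiv M' (Equiv.swap 0 i) (Equiv.swap 0 j)).trans ?_
      exact (mutualFactors_oneBlock _ (by simpa using hij)).trans hq.oneBlock

end DetIdeal

section Homogeneous

variable {σ R : Type*} [CommRing R]

theorem MvPolynomial.IsHomogeneous.det_of_X {s : ℕ} (v : Fin s → Fin s → σ) :
    (Matrix.of fun i j => (X (v i j) : MvPolynomial σ R)).det.IsHomogeneous s := by
  rw [Matrix.det_apply]
  refine IsHomogeneous.sum _ _ _ fun e _ => ?_
  have h : (∏ i, Matrix.of (fun i j => (X (v i j) : MvPolynomial σ R)) (e i) i).IsHomogeneous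
      (∑ _i : Fin s, 1) :=
    IsHomogeneous.prod _ _ _ fun i _ => isHomogeneous_X _ _
  have h' : (∑ _i : Fin s, 1) = s := by simp
  rw [h'] at h
  rcases Int.units_eq_one_or (Equiv.Perm.sign e) with h1 | h1 <;> rw [h1]
  · simpa using h
  · simpa using h.neg

/-- The homogeneous polynomials (of any degree) form a submonoid. -/
def homogeneousSubmonoid (σ R : Type*) [CommRing R] : Submonoid (MvPolynomial σ R) where
  carrier := {f | ∃ d, f.IsHomogeneous d}
  one_mem' := ⟨0, isHomogeneous_one _ _⟩
  mul_mem' := fun ⟨d, h⟩ ⟨e, h'⟩ => ⟨d + e, h.mul h'⟩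

end Homogeneous

section Minors

variable {𝔽 : Type*} [Field 𝔽] {m n : ℕ}

theorem intervalMinor_eq_det (hm : 0 < m) (hn : 0 < n) (s r0 c0 : ℕ) :
    ∃ (f : Fin s → Fin m) (g : Fin s → Fin n),
      intervalMinor 𝔽 m n s r0 c0 = ((genMat 𝔽 m n).submatrix f g).det := by
  rw [intervalMinor, dif_pos ⟨hm, hn⟩]
  exact ⟨fun i => ⟨min (r0 + i) (m - 1), by omega⟩,
    fun j => ⟨min (c0 + j) (n - 1), by omega⟩, rfl⟩

theorem intervalMinor_mem_homogeneousSubmonoid (s r0 c0 : ℕ) :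
    intervalMinor 𝔽 m n s r0 c0 ∈ homogeneousSubmonoid (Fin m × Fin n) 𝔽 := by
  rw [intervalMinor]
  split_ifs with h
  · exact ⟨s, IsHomogeneous.det_of_X _⟩
  · exact ⟨0, isHomogeneous_zero _ _ _⟩

theorem Delta_mem_homogeneousSubmonoid (k : ℕ) :
    Delta 𝔽 m n k ∈ homogeneousSubmonoid (Fin m × Fin n) 𝔽 :=
  mul_mem (prod_mem fun _ _ => intervalMinor_mem_homogeneousSubmonoid _ _ _)
    (prod_mem fun _ _ => mul_mem (intervalMinor_mem_homogeneousSubmonoid _ _ _)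
      (intervalMinor_mem_homogeneousSubmonoid _ _ _))

theorem DeltaMain_mem_homogeneousSubmonoid (t k : ℕ) :
    DeltaMain 𝔽 m n t k ∈ homogeneousSubmonoid (Fin m × Fin n) 𝔽 := by
  have h' : Delta' 𝔽 m n k ∈ homogeneousSubmonoid (Fin m × Fin n) 𝔽 :=
    mul_mem (Delta_mem_homogeneousSubmonoid k) (intervalMinor_mem_homogeneousSubmonoid _ _ _)
  rw [DeltaMain]
  split_ifs
  · exact pow_mem (Delta_mem_homogeneousSubmonoid _) _
  · exact mul_mem (pow_mem (Delta_mem_homogeneousSubmonoid _) _) (pow_mem h' _)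
  · exact mul_mem (pow_mem h' _) (pow_mem (Delta_mem_homogeneousSubmonoid _) _)

theorem detIdeal_genMat_le_minorsIdeal (t : ℕ) :
    (genMat 𝔽 m n).detIdeal t ≤ minorsIdeal 𝔽 m n t := by
  refine Ideal.span_le.2 ?_
  rintro _ ⟨f, g, rfl⟩
  by_cases hf : Function.Injective f
  swap
  · obtain ⟨i, j, hij, hne⟩ : ∃ i j, f i = f j ∧ i ≠ j := by
      simpa [Function.Injective] using hf
    rw [Matrix.det_zero_of_row_eq hne (by ext; simp [hij])]
    exact zero_mem _
  by_cases hg : Function.Injective g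
  swap
  · obtain ⟨i, j, hij, hne⟩ : ∃ i j, g i = g j ∧ i ≠ j := by
      simpa [Function.Injective] using hg
    rw [Matrix.det_zero_of_column_eq hne (by intro; simp [hij])]
    exact zero_mem _
  have hsort : ∀ {l : ℕ} {h : Fin t → Fin l}, Function.Injective h →
      StrictMono (h ∘ Tuple.sort h) := fun hh =>
    (Tuple.monotone_sort _).strictMono_of_injective (hh.comp (Equiv.injective _))
  have hmem : ((genMat 𝔽 m n).submatrix (f ∘ Tuple.sort f) (g ∘ Tuple.sort g)).det ∈
      minorsIdeal 𝔽 m n t :=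
    Ideal.subset_span ⟨_, _, hsort hf, hsort hg, rfl⟩
  have heq : (genMat 𝔽 m n).submatrix f g =
      (((genMat 𝔽 m n).submatrix (f ∘ Tuple.sort f) (g ∘ Tuple.sort g)).submatrix
        (Tuple.sort f).symm id).submatrix id (Tuple.sort g).symm := by
    ext i j
    simp
  rw [heq, Matrix.det_permute', Matrix.det_permute]
  exact Ideal.mul_mem_left _ _ (Ideal.mul_mem_left _ _ hmem)

end Minors

section Exponents

/-- The sum of the truncated differences `s - a` over the sizes `s` of the minors
occurring in `Delta`. -/
def deltaExponent (m n k a : ℕ) : ℕ :=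
  ∑ _i ∈ Finset.range (n - m + 1), (m - a) +
    ∑ j ∈ Finset.Icc 2 (m - k), ((m - j + 1 - a) + (m - j + 1 - a))

theorem deltaExponent_add {m n k a : ℕ} (hmn : m ≤ n) (hk : k < m) (ha : a < m) :
    deltaExponent m n k a + (k - a) * (k - a + 1) = (m - a) * (n - a) := by
  obtain ⟨b, hb, rfl⟩ : ∃ b, b + 1 ≤ m ∧ k = m - (b + 1) := ⟨m - k - 1, by omega, by omega⟩
  obtain ⟨c, rfl⟩ := Nat.exists_eq_add_of_le hmn
  clear hk
  rw [deltaExponent]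
  have hmk : m - (m - (b + 1)) = b + 1 := by omega
  rw [hmk]
  induction b with
  | zero =>
    obtain ⟨x, rfl⟩ : ∃ x, m = a + x + 1 := ⟨m - a - 1, by omega⟩
    simp only [Finset.sum_const, Finset.card_range, smul_eq_mul]
    have h1 : a + x + 1 + c - (a + x + 1) + 1 = c + 1 := by omega
    have h2 : a + x + 1 - a = x + 1 := by omega
    have h3 : a + x + 1 - (0 + 1) - a = x := by omega
    have h4 : a + x + 1 + c - a = x + 1 + c := by omega
    rw [h1, h2, h3, h4]
    simp
    ring
  | succ b ih =>
    have ih := ih (by omega) (by omega)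
    rw [Finset.sum_Icc_succ_top (by omega)]
    have h1 : m - (b + 1 + 1) + 1 - a = m - (b + 1) - a := by omega
    rw [h1]
    rcases Nat.eq_zero_or_pos (m - (b + 1) - a) with h0 | h0
    · have h2 : m - (b + 1 + 1) - a = 0 := by omega
      rw [h0] at ih ⊢
      rw [h2]
      linarith
    · obtain ⟨x, hx⟩ : ∃ x, m - (b + 1) - a = x + 1 := ⟨_, (Nat.succ_pred_eq_of_pos h0).symm⟩
      have h2 : m - (b + 1 + 1) - a = x := by omega
      rw [hx] at ih ⊢
      rw [h2]
      linarith

theorem minCond_add_iff (k s α β : ℕ) :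
    minCond (k + s + 1) (k + s + 1 + α) (k + s + 1 + β) k ↔ (s + 1) * s ≤ α * β := by
  have h1 : k + s + 1 + α - k = s + 1 + α := by omega
  have h2 : k + s + 1 + β - k = s + 1 + β := by omega
  have h3 : k + s + 1 - k = s + 1 := by omega
  have h4 : s + 1 + α - 1 = s + α := by omega
  have h5 : s + 1 + β - 1 = s + β := by omega
  rw [minCond, h1, h2, h3, h4, h5, Nat.add_sub_cancel, Nat.add_sub_cancel]
  rcases Nat.eq_zero_or_pos s with rfl | hs
  · simp
  · have hs' : (0 : ℝ) < s := by exact_mod_cast hs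
    have hk : k ≠ k + s := by omega
    rw [div_le_div_iff₀ (by positivity) (by positivity), ← Nat.cast_le (α := ℝ)]
    simp only [hk, false_or]
    push_cast
    constructor <;> intro h <;> linarith

theorem mul_le_mul_of_minCond {k s α β a : ℕ} (h : (s + 1) * s ≤ α * β) (hka : k ≤ a) :
    (s + 1 + α) * (s + 1 + β) * (k + s + 1 - a) ≤
      (s + 1) * ((k + s + 1 + α - a) * (k + s + 1 + β - a)) := by
  rcases Nat.lt_or_ge a (k + s + 1) with ha | ha
  · obtain ⟨x, rfl⟩ := Nat.exists_eq_add_of_le hka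
    obtain ⟨y, rfl⟩ : ∃ y, s = x + y := ⟨s - x, by omega⟩
    have h1 : k + (x + y) + 1 - (k + x) = y + 1 := by omega
    have h2 : k + (x + y) + 1 + α - (k + x) = y + 1 + α := by omega
    have h3 : k + (x + y) + 1 + β - (k + x) = y + 1 + β := by omega
    rw [h1, h2, h3]
    rcases Nat.eq_zero_or_pos x with rfl | hx
    · simp only [zero_add]
      exact le_of_eq (by ring)
    · have h4 : (x + y + 1) * (y + 1) ≤ α * β :=
        (Nat.mul_le_mul_left _ (by omega)).trans h
      nlinarith [Nat.mul_le_mul_left x h4]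
  · rw [Nat.sub_eq_zero_of_le ha]
    simp

end Exponents

section Divisibility

variable {V : Type*} [CommRing V]

/-- The monomial `∏_{a < m} q a ^ e a`. -/
def rangeMonomial (m : ℕ) (q : ℕ → V) (e : ℕ → ℕ) : V :=
  ∏ a ∈ Finset.range m, q a ^ e a

variable {m : ℕ} {q : ℕ → V}

theorem rangeMonomial_dvd_mul {e e' : ℕ → ℕ} {x y : V} (h : rangeMonomial m q e ∣ x)
    (h' : rangeMonomial m q e' ∣ y) : rangeMonomial m q (fun a => e a + e' a) ∣ x * y := by
  have : rangeMonomial m q (fun a => e a + e' a) =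
      rangeMonomial m q e * rangeMonomial m q e' := by
    simp [rangeMonomial, pow_add, Finset.prod_mul_distrib]
  rw [this]
  exact mul_dvd_mul h h'

theorem rangeMonomial_pow (e : ℕ → ℕ) (c : ℕ) :
    rangeMonomial m q (fun a => c * e a) = rangeMonomial m q e ^ c := by
  simp [rangeMonomial, mul_comm c, pow_mul, Finset.prod_pow]

theorem rangeMonomial_dvd_pow {e : ℕ → ℕ} {x : V} (h : rangeMonomial m q e ∣ x) (c : ℕ) :
    rangeMonomial m q (fun a => c * e a) ∣ x ^ c := by
  rw [rangeMonomial_pow]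
  exact pow_dvd_pow_of_dvd h c

theorem rangeMonomial_dvd_prod {α : Type*} {s : Finset α} {e : α → ℕ → ℕ} {x : α → V}
    (h : ∀ i ∈ s, rangeMonomial m q (e i) ∣ x i) :
    rangeMonomial m q (fun a => ∑ i ∈ s, e i a) ∣ ∏ i ∈ s, x i := by
  have : rangeMonomial m q (fun a => ∑ i ∈ s, e i a) = ∏ i ∈ s, rangeMonomial m q (e i) := by
    simp_rw [rangeMonomial, ← Finset.prod_pow_eq_pow_sum]
    exact Finset.prod_comm
  rw [this]
  exact Finset.prod_dvd_prod_of_dvd _ _ h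

theorem rangeMonomial_dvd_rangeMonomial {e e' : ℕ → ℕ} (h : ∀ a < m, e a ≤ e' a) :
    rangeMonomial m q e ∣ rangeMonomial m q e' :=
  Finset.prod_dvd_prod_of_dvd _ _ fun a ha => pow_dvd_pow _ (h a (Finset.mem_range.1 ha))

variable {𝔽 : Type*} [Field 𝔽] {n : ℕ} {φ : MvPolynomial (Fin m × Fin n) 𝔽 →+* V}

theorem rangeMonomial_dvd_map_Delta
    (H : ∀ s r c, s ≤ m → rangeMonomial m q (fun a => s - a) ∣ φ (intervalMinor 𝔽 m n s r c))
    (k : ℕ) (hm : 0 < m) : rangeMonomial m q (deltaExponent m n k) ∣ φ (Delta 𝔽 m n k) := by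
  rw [Delta, map_mul, map_prod, map_prod]
  refine rangeMonomial_dvd_mul (rangeMonomial_dvd_prod fun i _ => H _ _ _ le_rfl)
    (rangeMonomial_dvd_prod fun j hj => ?_)
  rw [map_mul]
  have := Finset.mem_Icc.1 hj
  exact rangeMonomial_dvd_mul (H _ _ _ (by omega)) (H _ _ _ (by omega))

theorem rangeMonomial_dvd_map_DeltaMain {t k : ℕ} (ht : 0 < t) (htm : t ≤ m) (hmn : m ≤ n)
    (hk : k ≤ t - 1) (hCk : minCond t m n k) (hleast : ∀ j : ℕ, j < k → ¬ minCond t m n j)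
    (H : ∀ s r c, s ≤ m → rangeMonomial m q (fun a => s - a) ∣ φ (intervalMinor 𝔽 m n s r c)) :
    rangeMonomial m q (fun a => (m - k) * (n - k) * (t - a)) ∣ φ (DeltaMain 𝔽 m n t k) := by
  obtain ⟨s, rfl⟩ : ∃ s, t = k + s + 1 := ⟨t - 1 - k, by omega⟩
  obtain ⟨α, rfl⟩ := Nat.exists_eq_add_of_le htm
  obtain ⟨β, rfl⟩ := Nat.exists_eq_add_of_le (htm.trans hmn)
  rw [minCond_add_iff] at hCk
  have hu : uInt (k + s + 1) (k + s + 1 + α) (k + s + 1 + β) k = (s + 1) ^ 2 - α * β := by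
    rw [uInt]; push_cast; ring
  have hDelta := fun k => rangeMonomial_dvd_map_Delta H k (by omega)
  have hDelta' : rangeMonomial (k + s + 1 + α) q _ ∣ φ (Delta' 𝔽 _ _ k) :=
    (rangeMonomial_dvd_mul (hDelta k) (H k (k + s + 1 + α - k) 0 (by omega))).trans
      (by rw [Delta', map_mul])
  have hmk : k + s + 1 + α - k = s + 1 + α := by omega
  have hnk : k + s + 1 + β - k = s + 1 + β := by omega
  rw [hmk, hnk, DeltaMain]
  have hCZ : ((s : ℤ) + 1) * s ≤ α * β := by exact_mod_cast hCk
  have htk : ((k + s + 1 : ℕ) : ℤ) - (k : ℤ) = s + 1 := by push_cast; ring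
  rw [hu, htk]
  split_ifs with h0 hpos
  · subst h0
    rw [map_pow]
    refine dvd_trans ?_ (rangeMonomial_dvd_pow (hDelta 0) _)
    refine rangeMonomial_dvd_rangeMonomial fun a ha => ?_
    have h1 := deltaExponent_add hmn (show 0 < 0 + s + 1 + α by omega) ha
    have h2 := mul_le_mul_of_minCond hCk (Nat.zero_le a)
    rw [Nat.zero_sub, zero_mul, add_zero] at h1
    rw [h1]
    simpa using h2
  · rw [map_mul, map_pow, map_pow]
    refine dvd_trans ?_ (rangeMonomial_dvd_mul (rangeMonomial_dvd_pow (hDelta k) _)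
      (rangeMonomial_dvd_pow hDelta' _))
    refine rangeMonomial_dvd_rangeMonomial fun a ha => ?_
    have h1 := deltaExponent_add hmn (show k < k + s + 1 + α by omega) ha
    obtain ⟨v, hv⟩ := Int.eq_ofNat_of_zero_le hpos
    obtain ⟨w, hw⟩ := Int.eq_ofNat_of_zero_le
      (show (0 : ℤ) ≤ s + 1 - ((s + 1) ^ 2 - α * β) by linarith)
    rw [hw, hv, Int.toNat_natCast, Int.toNat_natCast]
    have hvw : v + w = s + 1 := by zify; linarith
    rcases Nat.lt_or_ge a k with hak | hak
    · obtain ⟨x, rfl⟩ := Nat.exists_eq_add_of_lt hak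
      have e1 : a + x + 1 - a = x + 1 := by omega
      have e2 : a + x + 1 + s + 1 + α - a = x + s + 2 + α := by omega
      have e3 : a + x + 1 + s + 1 + β - a = x + s + 2 + β := by omega
      have e4 : a + x + 1 + s + 1 - a = x + s + 2 := by omega
      rw [e1, e2, e3] at h1
      rw [e1, e4]
      zify at h1 hvw ⊢
      have hw' : (w : ℤ) = s + 1 - v := by linarith
      have hE := eq_sub_of_add_eq h1
      rw [hE, hw', ← hv]
      apply le_of_eq
      ring
    · have h2 := mul_le_mul_of_minCond hCk hak
      rw [Nat.sub_eq_zero_of_le hak, zero_mul, add_zero] at h1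
      rw [Nat.sub_eq_zero_of_le hak, h1, add_zero, ← add_mul, hvw]
      exact h2
  · obtain ⟨k, rfl⟩ := Nat.exists_eq_succ_of_ne_zero h0
    rw [Nat.succ_eq_add_one, Nat.add_sub_cancel] at *
    have hlt := hleast k (by omega)
    have e0 : k + 1 + s + 1 = k + (s + 1) + 1 := by ring
    rw [e0, minCond_add_iff, not_le] at hlt
    have hltZ : (α : ℤ) * β < (s + 1 + 1) * (s + 1) := by exact_mod_cast hlt
    rw [map_mul, map_pow, map_pow]
    refine dvd_trans ?_ (rangeMonomial_dvd_mul (rangeMonomial_dvd_pow hDelta' _)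
      (rangeMonomial_dvd_pow (hDelta k) _))
    refine rangeMonomial_dvd_rangeMonomial fun a ha => ?_
    have h1 := deltaExponent_add hmn (show k + 1 < k + 1 + s + 1 + α by omega) ha
    have h1' := deltaExponent_add hmn (show k < k + 1 + s + 1 + α by omega) ha
    obtain ⟨v, hv⟩ := Int.eq_ofNat_of_zero_le
      (show (0 : ℤ) ≤ -((s + 1) ^ 2 - α * β) by linarith)
    obtain ⟨w, hw⟩ := Int.eq_ofNat_of_zero_le
      (show (0 : ℤ) ≤ s + 1 + ((s + 1) ^ 2 - α * β) by linarith)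
    rw [hw, hv, Int.toNat_natCast, Int.toNat_natCast]
    have hvw : w + v = s + 1 := by zify; linarith
    rcases Nat.lt_or_ge a (k + 1) with hak | hak
    · obtain ⟨x, rfl⟩ := Nat.exists_eq_add_of_le (Nat.le_of_lt_succ hak)
      have e1 : a + x + 1 - a = x + 1 := by omega
      have e1' : a + x - a = x := by omega
      have e2 : a + x + 1 + s + 1 + α - a = x + s + 2 + α := by omega
      have e3 : a + x + 1 + s + 1 + β - a = x + s + 2 + β := by omega
      have e4 : a + x + 1 + s + 1 - a = x + s + 2 := by omega
      rw [e1, e2, e3] at h1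
      rw [e1', e2, e3] at h1'
      rw [e1, e4]
      zify at h1 h1' hvw ⊢
      have hw' : (w : ℤ) = s + 1 - v := by linarith
      rw [eq_sub_of_add_eq h1, eq_sub_of_add_eq h1', hw']
      have hv' : (v : ℤ) = -((s + 1) ^ 2 - α * β) := hv.symm
      rw [hv']
      apply le_of_eq
      ring
    · have h2 := mul_le_mul_of_minCond hCk hak
      rw [Nat.sub_eq_zero_of_le hak, zero_mul, add_zero] at h1
      rw [Nat.sub_eq_zero_of_le (by omega : k ≤ a), zero_mul, add_zero] at h1'
      rw [Nat.sub_eq_zero_of_le hak, h1, h1', add_zero, ← add_mul, hvw]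
      exact h2

/-- `DeltaMain` lies in the extension of the relevant power of the ideal of minors to any
valuation ring. -/
theorem map_DeltaMain_mem_map_minorsIdeal_pow [IsDomain V] [ValuationRing V]
    (φ : MvPolynomial (Fin m × Fin n) 𝔽 →+* V) {t k : ℕ} (ht : 0 < t) (htm : t ≤ m)
    (hmn : m ≤ n) (hk : k ≤ t - 1) (hCk : minCond t m n k)
    (hleast : ∀ j : ℕ, j < k → ¬ minCond t m n j) :
    φ (DeltaMain 𝔽 m n t k) ∈ (minorsIdeal 𝔽 m n t ^ ((m - k) * (n - k))).map φ := by
  obtain ⟨q, hq⟩ :=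
    Matrix.exists_mutualFactors_partialProdDiag m n ((genMat 𝔽 m n).map φ)
  have hdet : ∀ {s : ℕ} (f : Fin s → Fin m) (g : Fin s → Fin n),
      φ ((genMat 𝔽 m n).submatrix f g).det = (((genMat 𝔽 m n).map φ).submatrix f g).det :=
    fun f g => by rw [RingHom.map_det]; rfl
  have hdvd : rangeMonomial m q (fun a => (m - k) * (n - k) * (t - a)) ∣
      φ (DeltaMain 𝔽 m n t k) := by
    refine rangeMonomial_dvd_map_DeltaMain ht htm hmn hk hCk hleast fun s r c hs => ?_
    obtain ⟨f, g, hfg⟩ :=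
      intervalMinor_eq_det (𝔽 := 𝔽) (show 0 < m by omega) (show 0 < n by omega) s r c
    have hmem := Matrix.det_mem_detIdeal ((genMat 𝔽 m n).map φ) f g
    rw [hq.detIdeal_eq] at hmem
    have hmem := Matrix.detIdeal_partialProdDiag_le q s hmem
    rw [Finset.prod_range_prod_range_succ q s m hs, Ideal.mem_span_singleton] at hmem
    rw [hfg, hdet]
    exact hmem
  have hle : ((genMat 𝔽 m n).map φ).detIdeal t ≤ (minorsIdeal 𝔽 m n t).map φ := by
    refine Ideal.span_le.2 ?_
    rintro _ ⟨f, g, rfl⟩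
    rw [← hdet]
    exact Ideal.mem_map_of_mem φ
      (detIdeal_genMat_le_minorsIdeal t (Matrix.det_mem_detIdeal _ f g))
  have hmem := Matrix.prod_mem_detIdeal_partialProdDiag q htm (htm.trans hmn)
  rw [← hq.detIdeal_eq, Finset.prod_range_prod_range_succ q t m htm] at hmem
  rw [rangeMonomial_pow] at hdvd
  rw [Ideal.map_pow]
  exact Ideal.mem_of_dvd _ hdvd (Ideal.pow_mem_pow (hle hmem) _)

end Divisibility

/-- Let `k` be the least integer in `[0, t-1]` with
`(m-k)(n-k)/(t-k) ≤ (m-k-1)(n-k-1)/(t-k-1)` (division by zero read as infinity), and let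
`Δ` be as constructed above.  Since `Δ` lies in the integral closure of
`I_t^{(m-k)(n-k)}`, there is a nonzero homogeneous `f` with `f·Δ^l ∈ I_t^{(m-k)(n-k)l}`
for all `l ≥ 1`. -/
theorem exists_multiplier_for_Delta (p : ℕ) (hp : p.Prime)
    (𝔽 : Type*) [Field 𝔽] [CharP 𝔽 p]
    (m n t : ℕ) (ht : 0 < t) (htm : t ≤ m) (hmn : m ≤ n)
    (k : ℕ) (hk : k ≤ t - 1) (hCk : minCond t m n k)
    (hleast : ∀ j : ℕ, j < k → ¬ minCond t m n j) :
    ∃ f : MvPolynomial (Fin m × Fin n) 𝔽, f ≠ 0 ∧ (∃ d : ℕ, f.IsHomogeneous d) ∧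
      ∀ l : ℕ, 1 ≤ l →
        f * DeltaMain 𝔽 m n t k ^ l ∈ minorsIdeal 𝔽 m n t ^ ((m - k) * (n - k) * l) := by
  by_cases h0 : DeltaMain 𝔽 m n t k = 0
  · refine ⟨1, one_ne_zero, ⟨0, isHomogeneous_one _ _⟩, fun l hl => ?_⟩
    rw [h0, zero_pow (by omega), mul_zero]
    exact zero_mem _
  · obtain ⟨d, hd⟩ := exists_pow_mul_pow_mem_pow
      (K := FractionRing (MvPolynomial (Fin m × Fin n) 𝔽)) h0 fun V φ =>
        map_DeltaMain_mem_map_minorsIdeal_pow φ ht htm hmn hk hCk hleast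
    refine ⟨_, pow_ne_zero d h0, pow_mem (DeltaMain_mem_homogeneousSubmonoid t k) d,
      fun l _ => ?_⟩
    rw [pow_mul]
    exact hd l
end
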